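/- arXiv:math/0703241 — 2 statements merged into one kernel-verified Lean document; each statement's English description precedes it below -/
import Mathlib

section
/- Any T3 subshift that is k-traceable for some k ∈ ℕ* is traceable: if Σ ⊆ A^ℕ is T3 and is the k-trace of a onesided cellular automaton on an alphabet B ⊆ A^k, then there exists a cellular automaton F on A with τ(F) = Σ. -/
variable {A : Type*}

/-- The onesided shift on `A^ℕ`. -/
def shiftN (z : ℕ → A) : ℕ → A := fun i => z (i + 1)

/-- The twosided shift on `A^ℤ`. -/
def shiftZ (x : ℤ → A) : ℤ → A := fun i => x (i + 1)

/-- A (onesided) subshift: a closed, shift-stable set of infinite words. -/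
def IsSubshift [TopologicalSpace A] (S : Set (ℕ → A)) : Prop :=
  IsClosed S ∧ ∀ z ∈ S, shiftN z ∈ S

/-- A 2-SFT: a subshift given by a set of forbidden words of length 2. -/
def IsTwoSFT (S : Set (ℕ → A)) : Prop :=
  ∃ Fb : Set (A × A), S = {z | ∀ i : ℕ, (z i, z (i + 1)) ∉ Fb}

/-- A k-SFT: a subshift given by a set of forbidden words of length k. -/
def IsKSFT (k : ℕ) (S : Set (ℕ → A)) : Prop :=
  ∃ Fb : Set (Fin k → A), S = {z | ∀ i : ℕ, (fun j : Fin k => z (i + (j : ℕ))) ∉ Fb}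

/-- A subshift of finite type. -/
def IsSFT (S : Set (ℕ → A)) : Prop := ∃ k : ℕ, IsKSFT k S

/-- A cellular automaton: a continuous self-map of `A^ℤ` commuting with the shift. -/
def IsCA [TopologicalSpace A] (F : (ℤ → A) → (ℤ → A)) : Prop :=
  Continuous F ∧ ∀ x, F (shiftZ x) = shiftZ (F x)

/-- The trace of `F` with initial condition `x`: the 0th column of the space-time diagram. -/
def caTrace (F : (ℤ → A) → (ℤ → A)) (x : ℤ → A) : ℕ → A := fun j => F^[j] x 0

/-- The trace subshift of `F`. -/
def traceSubshift (F : (ℤ → A) → (ℤ → A)) : Set (ℕ → A) := Set.range (caTrace F)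

/-- A subshift is traceable if it is the trace subshift of some CA. -/
def Traceable [TopologicalSpace A] (S : Set (ℕ → A)) : Prop :=
  ∃ F : (ℤ → A) → (ℤ → A), IsCA F ∧ traceSubshift F = S

/-- The q-th projection of an infinite word over the alphabet `A^k`. -/
def proj {k : ℕ} (q : Fin k) (z : ℕ → (Fin k → A)) : ℕ → A := fun j => z j q

/-- `π(Γ)`: the union of all projections. -/
def projAll {k : ℕ} (Γ : Set (ℕ → (Fin k → A))) : Set (ℕ → A) :=
  ⋃ q : Fin k, proj q '' Γ

/-- A subshift `S` on `A` is T1 if there is a 2-SFT `Γ ⊆ (A^k)^ℕ` with `π₀(Γ) = π(Γ) = S`. -/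
def IsT1 (S : Set (ℕ → A)) : Prop :=
  ∃ k : ℕ, ∃ hk : 0 < k, ∃ Γ : Set (ℕ → (Fin k → A)),
    IsTwoSFT Γ ∧ proj (⟨0, hk⟩ : Fin k) '' Γ = S ∧ projAll Γ = S

/-- A onesided CA: one admitting a local rule of anchor 0. -/
def IsOnesidedCA {C : Type*} (F : (ℤ → C) → (ℤ → C)) : Prop :=
  ∃ d : ℕ, ∃ f : (Fin d → C) → C, ∀ x i, F x i = f (fun j => x (i + (j : ℕ)))

/-- `S` is the k-trace of a onesided CA on some alphabet `B ⊆ A^k`. -/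
def KTraceable (k : ℕ) (S : Set (ℕ → A)) : Prop :=
  ∃ B : Set (Fin k → A), ∃ F : (ℤ → ↥B) → (ℤ → ↥B), IsOnesidedCA F ∧
    S = ⋃ q : Fin k, (fun z : ℕ → ↥B => fun j => ((z j : Fin k → A) q)) '' Set.range (caTrace F)

/-- `S` is a factor of `Γ`: a surjective continuous shift-commuting map from `Γ` onto `S`. -/
def IsFactorOf {B : Type*} [TopologicalSpace A] [TopologicalSpace B]
    (S : Set (ℕ → A)) (Γ : Set (ℕ → B)) : Prop :=
  ∃ φ : (ℕ → B) → (ℕ → A), ContinuousOn φ Γ ∧ φ '' Γ = S ∧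
    ∀ z ∈ Γ, φ (shiftN z) = shiftN (φ z)

/-- The language of a subshift: all finite factors of its elements. -/
def lang (S : Set (ℕ → A)) : Language A :=
  {w | ∃ z ∈ S, ∃ i : ℕ, w = List.ofFn (fun j : Fin w.length => z (i + (j : ℕ)))}

/-- A transitive subshift. -/
def IsTransitiveSubshift (S : Set (ℕ → A)) : Prop :=
  ∀ u ∈ lang S, ∀ v ∈ lang S, ∃ w : List A, u ++ w ++ v ∈ lang S

/-- A T2 subshift: sofic, and including an infinite transitive subshift. -/
def IsT2 [TopologicalSpace A] (S : Set (ℕ → A)) : Prop :=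
  (lang S).IsRegular ∧ ∃ Γ ⊆ S, IsSubshift Γ ∧ Γ.Infinite ∧ IsTransitiveSubshift Γ

/-- `B^ω`: infinite concatenations of words from `B ⊆ A^k`. -/
def Bomega {k : ℕ} (B : Set (Fin k → A)) : Set (ℕ → A) :=
  {z | ∀ i : ℕ, (fun q : Fin k => z (i * k + (q : ℕ))) ∈ B}

/-- A T3 subshift: T0 via a map `φ`, together with a periodic word `w ∉ φ(A)^*`. -/
def IsT3 (S : Set (ℕ → A)) : Prop :=
  ∃ φ : A → A, (∀ a : A, (fun j => φ^[j] a) ∈ S) ∧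
    ∃ w : List A, w ≠ [] ∧ (∃ a ∈ w, a ∉ Set.range φ) ∧
      ∃ z ∈ S, (∀ j : ℕ, z (j + w.length) = z j) ∧ ∀ i : Fin w.length, z (i : ℕ) = w.get i

/-- The data used to simulate a onesided cellular automaton on `B ⊆ A^k` by a cellular automaton
on `A`: the default rule `φ`, the periodic word `z` carried by the markers, and the number `R` of
blocks of a marker, taken large with respect to the period of `z` and to `k`. -/
structure MarkerCode (A : Type*) where
  φ : A → A
  z : ℕ → A
  p : ℕ
  k : ℕ
  R : ℕ
  B : Set (Fin k → A)
  dflt : B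
  d : ℕ
  f : (Fin d → B) → B
  pos : 0 < p
  periodic : ∀ j, z (j + p) = z j
  mark : ∃ j, z j ∉ Set.range φ
  large : 3 * p + k + 2 ≤ R

namespace MarkerCode

variable (E : MarkerCode A)

/-- The length of a marker. -/
def len : ℕ := E.R * (E.R + 1)

/-- The length of a supercell, made of a marker followed by a word of `B`. -/
def size : ℕ := E.len + E.k

/-- A marker of phase `t` starts at position `i`: for `r < R`, its `r`-th block consists of `r + 1`
copies of `z (t + r)` followed by `R - r` letters in the range of `φ`. -/
def IsMarker (x : ℤ → A) (i : ℤ) (t : ℕ) : Prop :=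
  ∀ r c : ℕ, r < E.R → c ≤ E.R →
    (c ≤ r → x (i + (r * (E.R + 1) + c : ℕ)) = E.z (t + r)) ∧
    (r < c → x (i + (r * (E.R + 1) + c : ℕ)) ∈ Set.range E.φ)

def HasMarker (x : ℤ → A) (i : ℤ) : Prop := ∃ t, E.IsMarker x i t

def content (x : ℤ → A) (i : ℤ) : Fin E.k → A := fun q => x (i + (E.len + q : ℕ))

/-- A valid supercell starts at position `i`. -/
def Valid (x : ℤ → A) (i : ℤ) : Prop :=
  E.HasMarker x i ∧ E.content x i ∈ E.B ∧ ∀ s : ℕ, 0 < s → s < E.size → ¬ E.HasMarker x (i + s)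

/-- A phase of the marker starting at position `i`. -/
noncomputable def phase (x : ℤ → A) (i : ℤ) : ℕ := Classical.epsilon (E.IsMarker x i)

open Classical in
noncomputable def ofWord (u : Fin E.k → A) : E.B := if h : u ∈ E.B then ⟨u, h⟩ else E.dflt

noncomputable def state (x : ℤ → A) (i : ℤ) : E.B := E.ofWord (E.content x i)

open Classical in
/-- The number of steps made by moving `m` times to the next supercell on the right, staying in
place if it is not valid. -/
noncomputable def steps (x : ℤ → A) (i : ℤ) : ℕ → ℕ
  | 0 => 0
  | m + 1 => if E.Valid x (i + ((steps x i m + 1) * E.size : ℕ)) then steps x i m + 1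
      else steps x i m

/-- The onesided configuration over `B` read from position `i`, extended by a constant. -/
noncomputable def ext (x : ℤ → A) (i : ℤ) (m : ℕ) : E.B :=
  E.state x (i + (E.steps x i m * E.size : ℕ))

/-- The new value of the letter at offset `o` in a valid supercell starting at `i`. -/
noncomputable def update (x : ℤ → A) (i : ℤ) (o : ℕ) : A :=
  if o < E.len then
    if o % (E.R + 1) ≤ o / (E.R + 1) then E.z (E.phase x i + o / (E.R + 1) + 1)
    else E.φ (x (i + o))
  else if h : o - E.len < E.k then
    (E.f fun j => E.ext x i j).1 ⟨o - E.len, h⟩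
  else E.φ (x (i + o))

open Classical in
/-- The cellular automaton updating valid supercells and applying `φ` everywhere else. -/
noncomputable def step (x : ℤ → A) (y : ℤ) : A :=
  if h : ∃ o : ℕ, o < E.size ∧ E.Valid x (y - o) then E.update x (y - h.choose) h.choose
  else E.φ (x y)

/-! ### Markers -/

variable {E} {x : ℤ → A} {i : ℤ}

theorem exists_mark (E : MarkerCode A) (a : ℕ) :
    ∃ r, r < E.p ∧ E.z (a + r) ∉ Set.range E.φ := by
  obtain ⟨j, hj⟩ := E.mark
  have hper : Function.Periodic E.z E.p := E.periodic
  have hp := E.pos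
  refine ⟨(j + a * E.p - a) % E.p, Nat.mod_lt _ hp, ?_⟩
  have hle : a ≤ a * E.p := Nat.le_mul_of_pos_right _ hp
  have h1 : E.z (a + (j + a * E.p - a) % E.p) = E.z j := by
    rw [← hper.map_mod_nat (a + _), Nat.add_mod_mod, hper.map_mod_nat,
      show a + (j + a * E.p - a) = j + a * E.p by omega]
    exact hper.nat_mul a j
  rwa [h1]

theorem IsMarker.not_overlap {t t' s : ℕ} (h : E.IsMarker x i t) (h' : E.IsMarker x (i + s) t')
    (hs : 0 < s) (hsD : s ≤ (E.R - E.p - 1) * (E.R + 1)) : False := by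
  have hR := E.large
  obtain ⟨r0, hr0, hz⟩ := E.exists_mark (t' + 1)
  set Q := E.R + 1 with hQ
  -- the run of the block of index `r0 + 1` of the second marker
  have ones : ∀ c, c ≤ r0 + 1 → x (i + (s + (r0 + 1) * Q + c : ℕ)) ∉ Set.range E.φ := by
    intro c hc
    have := (h' (r0 + 1) c (by omega) (by omega)).1 hc
    rw [show i + (s + (r0 + 1) * Q + c : ℕ) = i + s + ((r0 + 1) * (E.R + 1) + c : ℕ) by
      push_cast; rw [hQ]; push_cast; ring, this, show t' + (r0 + 1) = t' + 1 + r0 by ring]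
    exact hz
  have zero_right : x (i + (s + (r0 + 1) * Q + (r0 + 2) : ℕ)) ∈ Set.range E.φ := by
    have := (h' (r0 + 1) (r0 + 2) (by omega) (by omega)).2 (by omega)
    rwa [show i + (s + (r0 + 1) * Q + (r0 + 2) : ℕ) = i + s + ((r0 + 1) * (E.R + 1) + (r0 + 2) : ℕ)
      by push_cast; rw [hQ]; push_cast; ring]
  have zero_left : x (i + (s + r0 * Q + E.R : ℕ)) ∈ Set.range E.φ := by
    have := (h' r0 E.R (by omega) le_rfl).2 (by omega)
    rwa [show i + (s + r0 * Q + E.R : ℕ) = i + s + (r0 * (E.R + 1) + E.R : ℕ)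
      by push_cast; rw [hQ]; push_cast; ring]
  obtain ⟨u, hu⟩ : ∃ u, u = s + (r0 + 1) * Q := ⟨_, rfl⟩
  have hQ0 : 0 < Q := by omega
  have hr : u / Q < E.R := by
    rw [Nat.div_lt_iff_lt_mul hQ0]
    have h1 : (r0 + 1) * Q ≤ E.p * Q := Nat.mul_le_mul_right _ hr0
    have h2 : (E.R - E.p - 1) * Q + E.p * Q + Q = E.R * Q := by
      rw [← Nat.add_mul, ← Nat.succ_mul]
      congr 1; omega
    omega
  have hdm := Nat.div_add_mod u Q
  have hmod := Nat.mod_lt u hQ0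
  set r := u / Q
  set c := u % Q
  rw [mul_comm] at hdm
  rw [← hu] at ones zero_right
  have hc : c ≤ r := by
    by_contra hcon
    have := (h r c hr (by omega)).2 (by omega)
    rw [← hQ, hdm] at this
    exact ones 0 (by omega) this
  have hone : E.z (t + r) ∉ Set.range E.φ := by
    have := (h r c hr (by omega)).1 hc
    rw [← hQ, hdm] at this
    rw [← this]
    exact ones 0 (by omega)
  have hc0 : c = 0 := by
    by_contra hcon
    have := (h r (c - 1) hr (by omega)).1 (by omega)
    rw [← hQ, show r * Q + (c - 1) = s + r0 * Q + E.R by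
      rw [Nat.succ_mul] at hu; omega] at this
    rw [this] at zero_left
    exact hone zero_left
  have hur : r * Q = u := by omega
  rcases lt_trichotomy r (r0 + 1) with hlt | heq | hgt
  · have := (h r (r + 1) hr (by omega)).2 (by omega)
    rw [← hQ, hur] at this
    exact ones (r + 1) (by omega) this
  · rw [heq] at hur
    omega
  · have := (h r (r0 + 2) hr (by omega)).1 (by omega)
    rw [← hQ, hur] at this
    rw [this] at zero_right
    exact hone zero_right

theorem HasMarker.not_overlap {j : ℤ} (h : E.HasMarker x i) (h' : E.HasMarker x j)
    (hij : i < j) (hD : j - i ≤ ((E.R - E.p - 1) * (E.R + 1) : ℕ)) : False := by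
  obtain ⟨t, ht⟩ := h
  obtain ⟨t', ht'⟩ := h'
  obtain ⟨s, hs⟩ := Int.eq_ofNat_of_zero_le (show 0 ≤ j - i by omega)
  obtain rfl : j = i + s := by omega
  exact ht.not_overlap ht' (by omega) (by omega)

/-- The largest shift excluded by `HasMarker.not_overlap` leaves little room in a supercell. -/
theorem size_eq (E : MarkerCode A) :
    E.size = (E.R - E.p - 1) * (E.R + 1) + (E.p + 1) * (E.R + 1) + E.k := by
  have hR := E.large
  rw [size, len, ← Nat.add_mul]
  congr 2; omega

theorem block_le (E : MarkerCode A) {r : ℕ} (hr : r ≤ E.R - E.p - 1) :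
    r * (E.R + 1) ≤ (E.R - E.p - 1) * (E.R + 1) := Nat.mul_le_mul_right _ hr

theorem IsMarker.phase_spec {t : ℕ} (h : E.IsMarker x i t) (r : ℕ) :
    E.z (E.phase x i + r) = E.z (t + r) := by
  have hex : ∃ t, E.IsMarker x i t := ⟨t, h⟩
  have hph : E.IsMarker x i (E.phase x i) := Classical.epsilon_spec hex
  have hR := E.large
  have key : ∀ a, E.z (a + r) = E.z (a + r % E.p) := by
    intro a
    have hper : Function.Periodic E.z E.p := E.periodic
    rw [← hper.map_mod_nat (a + r), ← hper.map_mod_nat (a + r % E.p), Nat.add_mod_mod]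
  have hlt := Nat.mod_lt r E.pos
  rw [key, key t, ← (h (r % E.p) 0 (by omega) (by omega)).1 (by omega),
    ← (hph (r % E.p) 0 (by omega) (by omega)).1 (by omega)]

/-! ### One step of the automaton -/

theorem Valid.unique {j y : ℤ} (hi : E.Valid x i) (hj : E.Valid x j) (hi1 : i ≤ y)
    (hi2 : y < i + E.size) (hj1 : j ≤ y) (hj2 : y < j + E.size) : i = j := by
  have key : ∀ i j : ℤ, E.Valid x i → E.Valid x j → j < i + E.size → ¬ i < j := by
    intro i j hi hj hlt h
    refine hi.2.2 (j - i).toNat (by omega) (by omega) ?_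
    rw [show i + ((j - i).toNat : ℤ) = j by omega]
    exact hj.1
  have h1 := key i j hi hj (by omega)
  have h2 := key j i hj hi (by omega)
  omega

theorem Valid.step_eq (h : E.Valid x i) {o : ℕ} (ho : o < E.size) :
    E.step x (i + o) = E.update x i o := by
  have hex : ∃ o' : ℕ, o' < E.size ∧ E.Valid x (i + o - o') := ⟨o, ho, by simpa using h⟩
  rw [step, dif_pos hex]
  obtain ⟨h1, h2⟩ := hex.choose_spec
  have := h.unique h2 (y := i + o) (by omega) (by omega) (by omega) (by omega)
  rw [show hex.choose = o by omega]
  congr 1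
  omega

theorem step_of_not_covered {y : ℤ} (h : ∀ i, E.Valid x i → i ≤ y → ¬ y < i + E.size) :
    E.step x y = E.φ (x y) := by
  rw [step, dif_neg]
  rintro ⟨o, ho, hv⟩
  exact h _ hv (by omega) (by omega)

theorem exists_valid_of_mark {y : ℤ} (h : E.step x y ∉ Set.range E.φ) :
    ∃ i, E.Valid x i ∧ i ≤ y ∧ y < i + E.size := by
  by_contra! hcon
  refine h ?_
  rw [step_of_not_covered fun i h1 h2 => not_lt.2 (hcon i h1 h2)]
  exact ⟨_, rfl⟩

theorem block_lt_len {r c : ℕ} (hr : r < E.R) (hc : c ≤ E.R) : r * (E.R + 1) + c < E.len := by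
  have : (r + 1) * (E.R + 1) ≤ E.R * (E.R + 1) := Nat.mul_le_mul_right _ hr
  rw [Nat.succ_mul] at this
  rw [len]
  omega

theorem Valid.isMarker_step {t : ℕ} (h : E.Valid x i) (ht : E.IsMarker x i t) :
    E.IsMarker (E.step x) i (t + 1) := by
  intro r c hr hc
  have hlt := E.block_lt_len hr hc
  have hdiv : (r * (E.R + 1) + c) / (E.R + 1) = r := by
    rw [mul_comm, Nat.mul_add_div (by omega), Nat.div_eq_of_lt (by omega), add_zero]
  have hmod : (r * (E.R + 1) + c) % (E.R + 1) = c := by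
    rw [mul_comm, Nat.mul_add_mod, Nat.mod_eq_of_lt (by omega)]
  rw [h.step_eq (by rw [size]; omega), update, if_pos hlt, hdiv, hmod]
  constructor
  · intro hcr
    rw [if_pos hcr, add_assoc, ht.phase_spec, show t + (r + 1) = t + 1 + r by ring]
  · intro hcr
    rw [if_neg (by omega)]
    exact ⟨_, rfl⟩

theorem Valid.content_step (h : E.Valid x i) :
    E.content (E.step x) i = (E.f fun j => E.ext x i j).1 := by
  funext q
  have hq := q.2
  rw [content, h.step_eq (by rw [size]; omega), update, if_neg (by omega),
    dif_pos (by omega)]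
  exact congrArg _ (Fin.ext (Nat.add_sub_cancel_left ..))

theorem Valid.hasMarker_step (h : E.Valid x i) : E.HasMarker (E.step x) i := by
  obtain ⟨t, ht⟩ := h.1
  exact ⟨_, h.isMarker_step ht⟩

theorem Valid.step_valid (h : E.Valid x i) : E.Valid (E.step x) i := by
  refine ⟨h.hasMarker_step, ?_, ?_⟩
  · rw [h.content_step]
    exact Subtype.coe_prop _
  · intro s hs hsn hM
    have hR := E.large
    have hsize := E.size_eq
    have hsD : (E.R - E.p - 1) * (E.R + 1) < s := by
      by_contra hcon
      exact h.hasMarker_step.not_overlap hM (by omega) (by omega)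
    obtain ⟨t, ht⟩ := id hM
    obtain ⟨r0, hr0, hz⟩ := E.exists_mark (t + (E.p + 1 + E.k))
    have hval := (ht (E.p + 1 + E.k + r0) 0 (by omega) (by omega)).1 (by omega)
    rw [← add_assoc t, add_zero] at hval
    rw [← hval] at hz
    obtain ⟨j, hj, hj1, hj2⟩ := exists_valid_of_mark hz
    have hle := E.block_le (show E.p + 1 + E.k + r0 ≤ E.R - E.p - 1 by omega)
    have hge : (E.p + 1) * (E.R + 1) + E.k ≤ (E.p + 1 + E.k + r0) * (E.R + 1) := by nlinarith
    have hij : i + E.size ≤ j := by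
      by_contra hcon
      refine h.2.2 (j - i).toNat (by omega) (by omega) ?_
      rw [show i + ((j - i).toNat : ℤ) = j by omega]
      exact hj.1
    exact hM.not_overlap hj.hasMarker_step (by omega) (by omega)

theorem valid_step_iff : E.Valid (E.step x) i ↔ E.Valid x i := by
  refine ⟨fun h => ?_, Valid.step_valid⟩
  obtain ⟨t, ht⟩ := h.1
  obtain ⟨r, hr, hz⟩ := E.exists_mark t
  have hR := E.large
  rw [← (ht r 0 (by omega) (by omega)).1 (by omega)] at hz
  obtain ⟨j, hj, hj1, hj2⟩ := exists_valid_of_mark hz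
  have hle := E.block_le (show r ≤ E.R - E.p - 1 by omega)
  have hsize := E.size_eq
  have hpos : 0 < (E.p + 1) * (E.R + 1) := by positivity
  rcases lt_trichotomy i j with hlt | rfl | hgt
  · refine absurd hj.hasMarker_step ?_
    have := h.2.2 (j - i).toNat (by omega) (by omega)
    rwa [show i + ((j - i).toNat : ℤ) = j by omega] at this
  · exact hj
  · have := hj.step_valid
    by_cases hlt : i < j + E.size
    · refine absurd h.1 ?_
      have := this.2.2 (i - j).toNat (by omega) (by omega)
      rwa [show j + ((i - j).toNat : ℤ) = i by omega] at this
    · omega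

theorem valid_iterate_iff (n : ℕ) : E.Valid (E.step^[n] x) i ↔ E.Valid x i := by
  induction n with
  | zero => rfl
  | succ n ih => rw [Function.iterate_succ_apply', valid_step_iff, ih]

/-! ### Simulation -/

theorem steps_step (m : ℕ) : E.steps (E.step x) i m = E.steps x i m := by
  induction m with
  | zero => rfl
  | succ m ih =>
    classical
    rw [steps, steps, ih]
    exact if_congr valid_step_iff rfl rfl

theorem Valid.steps_valid (h : E.Valid x i) (m : ℕ) :
    E.Valid x (i + (E.steps x i m * E.size : ℕ)) := by
  induction m with
  | zero => simpa [steps] using h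
  | succ m ih =>
    rw [steps]
    split_ifs with hv
    · exact hv
    · exact ih

theorem steps_add (m j : ℕ) :
    E.steps x i (m + j) =
      E.steps x i m + E.steps x (i + (E.steps x i m * E.size : ℕ)) j := by
  induction j with
  | zero => simp [steps]
  | succ j ih =>
    rw [← add_assoc, steps, ih, steps]
    have : i + ((E.steps x i m + E.steps x (i + (E.steps x i m * E.size : ℕ)) j + 1) * E.size : ℕ)
        = i + (E.steps x i m * E.size : ℕ) +
          ((E.steps x (i + (E.steps x i m * E.size : ℕ)) j + 1) * E.size : ℕ) := by
      push_cast; ring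
    rw [this]
    split_ifs <;> rfl

theorem ext_add (m j : ℕ) :
    E.ext x (i + (E.steps x i m * E.size : ℕ)) j = E.ext x i (m + j) := by
  rw [ext, ext, steps_add]
  congr 1
  push_cast; ring

theorem Valid.state_coe (h : E.Valid x i) : (E.state x i : Fin E.k → A) = E.content x i := by
  rw [state, ofWord, dif_pos h.2.1]

theorem Valid.state_step (h : E.Valid x i) : E.state (E.step x) i = E.f fun j => E.ext x i j := by
  apply Subtype.ext
  rw [h.step_valid.state_coe, h.content_step]

theorem Valid.ext_step (h : E.Valid x i) (m : ℕ) :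
    E.ext (E.step x) i m = E.f fun j => E.ext x i (m + j) := by
  rw [ext, steps_step, (h.steps_valid m).state_step]
  simp only [ext_add]

theorem Valid.ext_iterate {G : (ℤ → E.B) → (ℤ → E.B)}
    (hG : ∀ y i, G y i = E.f fun j => y (i + (j : ℕ))) (h : E.Valid x i) {y : ℤ → E.B}
    (hy : ∀ m : ℕ, E.ext x i m = y m) (n m : ℕ) :
    E.ext (E.step^[n] x) i m = G^[n] y m := by
  induction n generalizing m with
  | zero => exact hy m
  | succ n ih =>
    rw [Function.iterate_succ_apply', Function.iterate_succ_apply',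
      ((valid_iterate_iff n).2 h).ext_step, hG]
    simp only [ih, Nat.cast_add]

theorem Valid.iterate_content {G : (ℤ → E.B) → (ℤ → E.B)}
    (hG : ∀ y i, G y i = E.f fun j => y (i + (j : ℕ))) (h : E.Valid x i) {y : ℤ → E.B}
    (hy : ∀ m : ℕ, E.ext x i m = y m) (n : ℕ) (q : Fin E.k) :
    E.step^[n] x (i + (E.len + q : ℕ)) = (G^[n] y 0 : Fin E.k → A) q := by
  have h1 := h.ext_iterate hG hy n 0
  rw [Nat.cast_zero] at h1
  rw [← h1]
  have hv := (valid_iterate_iff n).2 h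
  simp only [ext, steps, Nat.zero_mul, Nat.cast_zero, add_zero, hv.state_coe]
  rfl

theorem Valid.isMarker_iterate {t : ℕ} (h : E.Valid x i) (ht : E.IsMarker x i t) (n : ℕ) :
    E.IsMarker (E.step^[n] x) i (t + n) := by
  induction n with
  | zero => exact ht
  | succ n ih =>
    rw [Function.iterate_succ_apply']
    exact ((valid_iterate_iff n).2 h).isMarker_step ih

theorem iterate_eq_of_not_covered {y : ℤ} (h : ∀ i, E.Valid x i → i ≤ y → ¬ y < i + E.size)
    (n : ℕ) : E.step^[n] x y = E.φ^[n] (x y) := by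
  induction n with
  | zero => rfl
  | succ n ih =>
    rw [Function.iterate_succ_apply', Function.iterate_succ_apply', step_of_not_covered, ih]
    exact fun i hi => h i ((valid_iterate_iff n).1 hi)

/-- Every trace is a shift of `z`, an orbit of `φ`, or a projection of a trace of `G`. -/
theorem trace_cases {G : (ℤ → E.B) → (ℤ → E.B)}
    (hG : ∀ y i, G y i = E.f fun j => y (i + (j : ℕ))) (x : ℤ → A) :
    (∃ m, caTrace E.step x = fun n => E.z (m + n)) ∨ (∃ a, caTrace E.step x = fun n => E.φ^[n] a) ∨
      ∃ y q, caTrace E.step x = fun n => (caTrace G y n).1 q := by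
  by_cases hc : ∃ i, E.Valid x i ∧ i ≤ 0 ∧ 0 < i + E.size
  · obtain ⟨i, h, hi0, hi1⟩ := hc
    obtain ⟨o, ho⟩ : ∃ o : ℕ, i + (o : ℤ) = 0 := ⟨(-i).toNat, by omega⟩
    by_cases hol : o < E.len
    · have hR := E.large
      have hdm := Nat.div_add_mod o (E.R + 1)
      have hmod := Nat.mod_lt o (show 0 < E.R + 1 by omega)
      have hdiv : o / (E.R + 1) < E.R := by
        rw [Nat.div_lt_iff_lt_mul (by omega)]
        exact hol
      rw [mul_comm] at hdm
      by_cases hcr : o % (E.R + 1) ≤ o / (E.R + 1)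
      · obtain ⟨t, ht⟩ := h.1
        refine Or.inl ⟨t + o / (E.R + 1), ?_⟩
        funext n
        have := (h.isMarker_iterate ht n _ _ hdiv (by omega)).1 hcr
        rw [hdm, ho] at this
        rw [caTrace, this, add_right_comm]
      · refine Or.inr (Or.inl ⟨x 0, ?_⟩)
        funext n
        rw [caTrace]
        induction n with
        | zero => rfl
        | succ n ih =>
          have := ((valid_iterate_iff n).2 h).step_eq (o := o) (by omega)
          rw [update, if_pos hol, if_neg hcr, ho, ih] at this
          rw [Function.iterate_succ_apply', Function.iterate_succ_apply', this]
    · have hok : o - E.len < E.k := by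
        rw [size] at hi1
        omega
      refine Or.inr (Or.inr ⟨fun m => E.ext x i m.toNat, ⟨o - E.len, hok⟩, ?_⟩)
      funext n
      have := h.iterate_content hG (y := fun m => E.ext x i m.toNat) (fun m => by simp) n
        ⟨o - E.len, hok⟩
      refine Eq.trans (congrArg (E.step^[n] x) ?_) this
      dsimp only
      omega
  · push Not at hc
    exact Or.inr (Or.inl ⟨x 0, funext fun n =>
      iterate_eq_of_not_covered (fun i h1 h2 => not_lt.2 (hc i h1 h2)) n⟩)

/-- The configuration of `A^ℤ` encoding `y`, with a supercell starting at every `m * size`. -/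
noncomputable def encode (E : MarkerCode A) (y : ℤ → E.B) (v : ℤ) : A :=
  let o := (v % E.size).toNat
  if o < E.len then
    if o % (E.R + 1) ≤ o / (E.R + 1) then E.z (o / (E.R + 1)) else E.φ (E.z 0)
  else if h : o - E.len < E.k then (y (v / E.size)).1 ⟨o - E.len, h⟩ else E.z 0

theorem size_pos (E : MarkerCode A) : 0 < E.size := by
  rw [size_eq]
  positivity

theorem encode_isMarker (y : ℤ → E.B) (m : ℤ) : E.IsMarker (E.encode y) (m * E.size) 0 := by
  intro r c hr hc
  have hlt := E.block_lt_len hr hc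
  have hdiv : (r * (E.R + 1) + c) / (E.R + 1) = r := by
    rw [mul_comm, Nat.mul_add_div (by omega), Nat.div_eq_of_lt (by omega), add_zero]
  have hmod : (r * (E.R + 1) + c) % (E.R + 1) = c := by
    rw [mul_comm, Nat.mul_add_mod, Nat.mod_eq_of_lt (by omega)]
  have hs : r * (E.R + 1) + c < E.size := by rw [size]; omega
  have ho : ((m * E.size + (r * (E.R + 1) + c : ℕ)) % E.size : ℤ).toNat
      = r * (E.R + 1) + c := by
    rw [Int.mul_add_emod_self_right, Int.emod_eq_of_lt (by omega) (by omega)]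
    rfl
  simp only [encode, ho, hdiv, hmod, if_pos hlt, zero_add]
  constructor
  · intro h
    rw [if_pos h]
  · intro h
    rw [if_neg (by omega)]
    exact ⟨_, rfl⟩

theorem encode_content (y : ℤ → E.B) (m : ℤ) : E.content (E.encode y) (m * E.size) = y m := by
  funext q
  have hq := q.2
  have hs : E.len + q < E.size := by rw [size]; omega
  have ho : ((m * E.size + (E.len + q : ℕ)) % E.size : ℤ).toNat = E.len + q := by
    rw [Int.mul_add_emod_self_right, Int.emod_eq_of_lt (by omega) (by omega)]
    rfl
  have hd : (m * E.size + (E.len + q : ℕ)) / E.size = m := by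
    rw [Int.mul_add_ediv_right _ _ (by have := E.size_pos; omega),
      Int.ediv_eq_zero_of_lt (by omega) (by omega), add_zero]
  simp only [content, encode, ho, hd]
  rw [if_neg (by omega), dif_pos (by omega)]
  exact congrArg _ (Fin.ext (Nat.add_sub_cancel_left ..))

theorem encode_valid (y : ℤ → E.B) (m : ℤ) : E.Valid (E.encode y) (m * E.size) := by
  refine ⟨⟨0, encode_isMarker y m⟩, ?_, ?_⟩
  · rw [encode_content]
    exact Subtype.coe_prop _
  · intro s hs hsn hM
    have hsize := E.size_eq
    have hR := E.large
    have hle := E.block_le (show E.p + 1 + E.k ≤ E.R - E.p - 1 by omega)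
    have hge : (E.p + 1) * (E.R + 1) + E.k ≤ (E.p + 1 + E.k) * (E.R + 1) := by nlinarith
    have h1 : E.HasMarker (E.encode y) (m * E.size) := ⟨0, encode_isMarker y m⟩
    have h2 : E.HasMarker (E.encode y) (m * E.size + E.size) :=
      ⟨0, by simpa [add_mul] using encode_isMarker y (m + 1)⟩
    by_cases hsD : s ≤ (E.R - E.p - 1) * (E.R + 1)
    · exact h1.not_overlap hM (by omega) (by omega)
    · exact hM.not_overlap h2 (by omega) (by omega)

theorem ext_encode (y : ℤ → E.B) (m : ℕ) : E.ext (E.encode y) 0 m = y m := by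
  have hv (j : ℕ) : E.Valid (E.encode y) (0 + (j * E.size : ℕ)) := by
    have := encode_valid y j
    rwa [zero_add, Nat.cast_mul]
  have hst : E.steps (E.encode y) 0 m = m := by
    induction m with
    | zero => rfl
    | succ m ih => rw [steps, ih, if_pos (hv _)]
  apply Subtype.ext
  rw [ext, hst, (hv m).state_coe, zero_add, Nat.cast_mul, encode_content]

theorem iterate_step_encode {G : (ℤ → E.B) → (ℤ → E.B)}
    (hG : ∀ y i, G y i = E.f fun j => y (i + (j : ℕ))) (y : ℤ → E.B) (n : ℕ) (q : Fin E.k) :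
    E.step^[n] (E.encode y) (E.len + q : ℕ) = (G^[n] y 0 : Fin E.k → A) q := by
  have hv : E.Valid (E.encode y) 0 := by simpa using encode_valid y 0
  simpa using hv.iterate_content hG (ext_encode y) n q

/-! ### Locality -/

variable {x' : ℤ → A} {i' : ℤ}

theorem isMarker_congr (h : ∀ m : ℕ, m < E.len → x (i + m) = x' (i' + m)) (t : ℕ) :
    E.IsMarker x i t ↔ E.IsMarker x' i' t := by
  refine forall₄_congr fun r c hr hc => ?_
  rw [h _ (E.block_lt_len hr hc)]

theorem valid_congr (h : ∀ m : ℕ, m < 2 * E.size → x (i + m) = x' (i' + m)) :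
    E.Valid x i ↔ E.Valid x' i' := by
  have hsz : E.size = E.len + E.k := rfl
  have hM (s : ℕ) (hs : s < E.size) : E.HasMarker x (i + s) ↔ E.HasMarker x' (i' + s) := by
    refine exists_congr fun t => isMarker_congr (fun m hm => ?_) t
    have := h (s + m) (by omega)
    push_cast at this
    rwa [add_assoc, add_assoc]
  have hC : E.content x i = E.content x' i' := by
    funext q
    have hq := q.2
    exact h _ (by omega)
  have h0 := hM 0 E.size_pos
  simp only [Nat.cast_zero, add_zero] at h0
  rw [Valid, Valid, h0, hC]
  refine and_congr_right fun _ => and_congr_right fun _ => forall₃_congr fun s _ hs => ?_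
  rw [hM s hs]

theorem phase_congr (h : ∀ m : ℕ, m < E.len → x (i + m) = x' (i' + m)) :
    E.phase x i = E.phase x' i' := by
  have : E.IsMarker x i = E.IsMarker x' i' := funext fun t => propext (isMarker_congr h t)
  rw [phase, phase, this]

theorem steps_le (m : ℕ) : E.steps x i m ≤ m := by
  induction m with
  | zero => rfl
  | succ m ih =>
    rw [steps]
    split_ifs <;> omega

theorem steps_congr {m : ℕ} (h : ∀ n : ℕ, n < (m + 3) * E.size → x (i + n) = x' (i' + n)) :
    E.steps x i m = E.steps x' i' m := by
  induction m with
  | zero => rfl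
  | succ m ih =>
    have ih := ih fun n hn => h n (hn.trans_le (Nat.mul_le_mul_right _ (by omega)))
    have hle : E.steps x i m ≤ m := steps_le m
    rw [steps, steps, ← ih]
    classical
    refine if_congr (valid_congr fun n hn => ?_) rfl rfl
    have := h ((E.steps x i m + 1) * E.size + n) (by nlinarith)
    rw [Nat.cast_add, ← add_assoc, ← add_assoc] at this
    exact this

theorem ext_congr {m : ℕ} (h : ∀ n : ℕ, n < (m + 3) * E.size → x (i + n) = x' (i' + n)) :
    E.ext x i m = E.ext x' i' m := by
  rw [ext, ext, ← steps_congr h]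
  have hle : E.steps x i m ≤ m := steps_le m
  have : E.content x (i + (E.steps x i m * E.size : ℕ)) =
      E.content x' (i' + (E.steps x i m * E.size : ℕ)) := by
    funext q
    have hq := q.2
    have hsz : E.size = E.len + E.k := rfl
    have := h (E.steps x i m * E.size + (E.len + q)) (by nlinarith)
    rw [Nat.cast_add, ← add_assoc, ← add_assoc] at this
    exact this
  rw [state, state, this]

theorem update_congr {o : ℕ} (ho : o < E.size)
    (h : ∀ n : ℕ, n < (E.d + 3) * E.size → x (i + n) = x' (i' + n)) :
    E.update x i o = E.update x' i' o := by
  have hsz : E.size = E.len + E.k := rfl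
  have hle : E.size ≤ (E.d + 3) * E.size := Nat.le_mul_of_pos_left _ (by omega)
  have h1 : E.phase x i = E.phase x' i' := phase_congr fun m hm => h m (by omega)
  have h2 : (fun j : Fin E.d => E.ext x i j) = fun j : Fin E.d => E.ext x' i' j := by
    funext j
    have hj := j.2
    exact ext_congr fun n hn => h n (hn.trans_le (Nat.mul_le_mul_right _ (by omega)))
  rw [update, update, h1, h2, h o (by omega)]

theorem step_congr {y y' : ℤ}
    (h : ∀ m : ℤ, -E.size ≤ m → m < ((E.d + 3) * E.size : ℕ) → x (y + m) = x' (y' + m)) :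
    E.step x y = E.step x' y' := by
  have hoff (o : ℕ) (ho : o < E.size) (n : ℕ) (hn : n < (E.d + 3) * E.size) :
      x (y - o + n) = x' (y' - o + n) := by
    have := h (n - o) (by omega) (by omega)
    rwa [← add_sub_assoc, ← add_sub_assoc, add_sub_right_comm, add_sub_right_comm] at this
  have h2 : 2 * E.size ≤ (E.d + 3) * E.size := Nat.mul_le_mul_right _ (by omega)
  have hP : (fun o : ℕ => o < E.size ∧ E.Valid x (y - o)) =
      fun o : ℕ => o < E.size ∧ E.Valid x' (y' - o) := by
    funext o
    exact propext (and_congr_right fun ho =>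
      valid_congr fun n hn => hoff o ho n (by omega))
  by_cases hex : ∃ o : ℕ, o < E.size ∧ E.Valid x (y - o)
  · obtain ⟨o, ho, hv⟩ := hex
    have hv' : E.Valid x' (y' - o) := (congrFun hP o ▸ (⟨ho, hv⟩ : _ ∧ _) : _ ∧ _).2
    have e1 := hv.step_eq ho
    have e2 := hv'.step_eq ho
    rw [sub_add_cancel] at e1 e2
    rw [e1, e2]
    exact update_congr ho (hoff o ho)
  · have hex' : ¬ ∃ o : ℕ, o < E.size ∧ E.Valid x' (y' - o) := by
      rwa [← show (∃ o : ℕ, o < E.size ∧ E.Valid x (y - o)) = _ from congrArg Exists hP]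
    have h0 := h 0 (by omega) (by have := E.size_pos; omega)
    rw [add_zero, add_zero] at h0
    rw [step, step, dif_neg hex, dif_neg hex', h0]

theorem isCA_step [TopologicalSpace A] [DiscreteTopology A] (E : MarkerCode A) : IsCA E.step := by
  constructor
  · refine continuous_pi fun y => continuous_discrete_rng.2 fun a => ?_
    refine isOpen_iff_mem_nhds.2 fun x hx => ?_
    have hfin : (Set.Icc (y - E.size) (y + ((E.d + 3) * E.size : ℕ))).Finite := Set.finite_Icc _ _
    filter_upwards [set_pi_mem_nhds hfin fun j _ => (isOpen_discrete {x j}).mem_nhds rfl]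
      with x' hx'
    rw [Set.mem_preimage, Set.mem_singleton_iff] at hx ⊢
    rw [← hx]
    refine step_congr fun m h1 h2 => ?_
    exact hx' (y + m) ⟨by omega, by omega⟩
  · intro x
    funext y
    refine step_congr fun m _ _ => ?_
    rw [shiftZ, add_right_comm]

end MarkerCode

theorem IsSubshift.shift_mem [TopologicalSpace A] {S : Set (ℕ → A)} (hS : IsSubshift S)
    {z : ℕ → A} (hz : z ∈ S) (m : ℕ) : (fun n => z (m + n)) ∈ S := by
  induction m with
  | zero => simpa using hz
  | succ m ih =>
    have := hS.2 _ ih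
    rwa [show shiftN (fun n => z (m + n)) = fun n => z (m + 1 + n) from
      funext fun n => by rw [shiftN]; congr 1; ring] at this

/-- Any T3 subshift that is k-traceable for some `k ≥ 1` is traceable. -/
theorem stmt9 [Fintype A] [TopologicalSpace A] [DiscreteTopology A]
    (hA : 2 ≤ Fintype.card A) (S : Set (ℕ → A)) (hS : IsSubshift S) (hT3 : IsT3 S)
    (k : ℕ) (hk : 0 < k) (hkt : KTraceable k S) :
    Traceable S := by
  obtain ⟨φ, hφ, w, hw, ⟨a, haw, ha⟩, z, hz, hper, hzw⟩ := hT3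
  obtain ⟨B, G, ⟨d, f, hG⟩, hSG⟩ := hkt
  have hmem : ∀ s, s ∈ S ↔ ∃ q : Fin k, ∃ y, (fun n => (caTrace G y n).1 q) = s := by
    intro s
    rw [hSG]
    simp
  obtain ⟨-, y₀, -⟩ := (hmem z).1 hz
  let E : MarkerCode A :=
    { φ := φ, z := z, p := w.length, k := k, R := 3 * w.length + k + 2, B := B, dflt := y₀ 0,
      d := d, f := f, pos := List.length_pos_iff.2 hw, periodic := hper
      mark := by
        obtain ⟨j, hj⟩ := List.get_of_mem haw
        exact ⟨j, by rwa [hzw, hj]⟩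
      large := le_rfl }
  refine ⟨E.step, E.isCA_step, Set.Subset.antisymm ?_ ?_⟩
  · rintro _ ⟨x, rfl⟩
    rcases MarkerCode.trace_cases (E := E) (G := G) hG x with ⟨m, h⟩ | ⟨b, h⟩ | ⟨y, q, h⟩
    · exact h ▸ hS.shift_mem hz m
    · exact h ▸ hφ b
    · exact h ▸ (hmem _).2 ⟨q, y, rfl⟩
  · intro s hs
    obtain ⟨q, y, rfl⟩ := (hmem s).1 hs
    have hshift (n : ℕ) (c : ℤ) (x : ℤ → A) :
        E.step^[n] (fun v => x (v + c)) = fun v => E.step^[n] x (v + c) := by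
      induction n with
      | zero => rfl
      | succ n ih =>
        rw [Function.iterate_succ_apply', Function.iterate_succ_apply', ih]
        funext v
        refine MarkerCode.step_congr fun m _ _ => ?_
        rw [add_right_comm]
    refine ⟨fun v => E.encode y (v + (E.len + q : ℕ)), ?_⟩
    funext n
    rw [caTrace, hshift]
    beta_reduce
    rw [zero_add]
    exact MarkerCode.iterate_step_encode (E := E) (G := G) hG y n q
end

section
/- Any subshift Σ on the alphabet A that is T3 and moreover satisfies one of the following is traceable: (i) Σ is T1; (ii) Σ is a subshift of finite type; (iii) Σ is T2 (sofic and includes an infinite transitive subshift). -/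
variable {A : Type*}

/-- Data for a cellular automaton whose macrocells consist of a border, made of cells following a
periodic word `z` and of filler cells following `φ`, and of `k` cells simulating a relation `R`. -/
structure MacroCell (A : Type*) where
  /-- the period of the border -/
  n : ℕ
  /-- the number of data cells -/
  k : ℕ
  /-- the periodic word followed by the border -/
  z : ℕ → A
  /-- the letter outside the range of `φ` -/
  a : A
  /-- the evolution of the cells outside of macrocells -/
  φ : A → A
  /-- the valid data -/
  B : Set (Fin k → A)
  /-- the allowed transitions between data -/
  R : (Fin k → A) → (Fin k → A) → Prop
  /-- a default transition -/
  next : (Fin k → A) → (Fin k → A)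
  z_add : ∀ j, z (j + n) = z j
  exists_z : ∃ j < n, z j = a
  φ_ne : ∀ b, φ b ≠ a
  next_mem : ∀ b ∈ B, next b ∈ B
  R_next : ∀ b ∈ B, R b (next b)

namespace MacroCell

/-- The spacing of the sparse part of the border. -/
def gap (D : MacroCell A) : ℕ := D.n + 1

/-- The length of the sparse part of the border. -/
def sparse (D : MacroCell A) : ℕ := D.n * D.gap

/-- The length of the border. -/
def border (D : MacroCell A) : ℕ := D.sparse + (2 * D.k + D.n + 2 * D.gap + D.sparse)

/-- The length of a macrocell. -/
def len (D : MacroCell A) : ℕ := D.border + D.k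

/-- The cells of the border that follow the periodic word. -/
def IsPhase (D : MacroCell A) (r : ℕ) : Prop := D.sparse ≤ r ∨ D.gap ∣ r

open Classical in
/-- The phase of a cell of the border in the periodic word. -/
noncomputable def phase (D : MacroCell A) (r : ℕ) : ℕ :=
  if D.sparse ≤ r then r - D.sparse else r / D.gap

/-- The data of the macrocell at position `i`. -/
def data (D : MacroCell A) (x : ℤ → A) (i : ℤ) : Fin D.k → A :=
  fun q => x (i + D.border + (q : ℕ))

/-- The border at position `i` is at time `t`. -/
def InPhase (D : MacroCell A) (x : ℤ → A) (i : ℤ) (t : ℕ) : Prop :=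
  ∀ r < D.border, D.IsPhase r → x (i + r) = D.z (t + D.phase r)

/-- There is a macrocell at position `i`. -/
def Cand (D : MacroCell A) (x : ℤ → A) (i : ℤ) : Prop :=
  (∃ t, D.InPhase x i t) ∧ (∀ r < D.border, ¬ D.IsPhase r → x (i + r) ≠ D.a) ∧ D.data x i ∈ D.B

/-- There is a macrocell at position `i` and it does not overlap any other one. -/
def Active (D : MacroCell A) (x : ℤ → A) (i : ℤ) : Prop :=
  D.Cand x i ∧ ∀ j, |j - i| < D.len → D.Cand x j → j = i

open Classical in
/-- The data at the next time step of the active macrocell at position `i`. -/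
noncomputable def newData (D : MacroCell A) (x : ℤ → A) (i : ℤ) : Fin D.k → A :=
  if D.Active x (i + D.len) ∧ D.R (D.data x i) (D.data x (i + D.len)) then D.data x (i + D.len)
  else D.next (D.data x i)

open Classical in
/-- The letter at the next time step in cell `r` of the active macrocell at position `i`. -/
noncomputable def newCell (D : MacroCell A) (x : ℤ → A) (i : ℤ) (r : ℕ) : A :=
  if h : D.border ≤ r ∧ r - D.border < D.k then D.newData x i ⟨r - D.border, h.2⟩
  else if D.IsPhase r then x (i + (D.sparse + (D.phase r + 1) % D.n : ℕ))
  else D.φ (x (i + r))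

open Classical in
/-- The cellular automaton associated with a macrocell. -/
noncomputable def ca (D : MacroCell A) (x : ℤ → A) (p : ℤ) : A :=
  if h : ∃ r : ℕ, r < D.len ∧ D.Active x (p - r) then D.newCell x (p - h.choose) h.choose
  else D.φ (x p)

theorem n_pos (D : MacroCell A) : 0 < D.n := by
  obtain ⟨j, hj, -⟩ := D.exists_z
  omega

theorem z_add_mul (D : MacroCell A) (j c : ℕ) : D.z (j + c * D.n) = D.z j := by
  induction c with
  | zero => simp
  | succ c ih => rw [Nat.succ_mul, ← Nat.add_assoc, D.z_add, ih]

theorem z_add_mod (D : MacroCell A) (t j : ℕ) : D.z (t + j % D.n) = D.z (t + j) := by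
  conv_rhs => rw [← Nat.mod_add_div j D.n, ← Nat.add_assoc, Nat.mul_comm, D.z_add_mul]

theorem exists_z_add (D : MacroCell A) (t : ℕ) : ∃ j < D.n, D.z (t + j) = D.a := by
  obtain ⟨j, hj, h⟩ := D.exists_z
  refine ⟨(j + t * D.n - t) % D.n, Nat.mod_lt _ D.n_pos, ?_⟩
  have : t ≤ t * D.n := Nat.le_mul_of_pos_right t D.n_pos
  rw [D.z_add_mod, ← h, ← D.z_add_mul j t]
  congr 1
  omega

theorem mul_gap_add_le (D : MacroCell A) {i : ℕ} (hi : i < D.n) : i * D.gap + D.gap ≤ D.sparse := by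
  rw [← Nat.succ_mul]
  exact Nat.mul_le_mul_right _ hi

theorem gap_le (D : MacroCell A) : D.gap ≤ D.sparse := by
  simpa using D.mul_gap_add_le D.n_pos

theorem InPhase.sparse {D : MacroCell A} {x : ℤ → A} {i : ℤ} {t : ℕ} (h : D.InPhase x i t) {j : ℕ}
    (hj : j < D.n) : x (i + (j * D.gap : ℕ)) = D.z (t + j) := by
  have h1 := D.mul_gap_add_le hj
  have hg : 0 < D.gap := Nat.succ_pos _
  rw [h _ (by unfold border; omega) (Or.inr ⟨j, Nat.mul_comm _ _⟩), phase, if_neg (by omega),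
    Nat.mul_div_cancel _ hg]

theorem InPhase.dense {D : MacroCell A} {x : ℤ → A} {i : ℤ} {t : ℕ} (h : D.InPhase x i t) {j : ℕ}
    (hj : D.sparse + j < D.border) : x (i + (D.sparse + j : ℕ)) = D.z (t + j) := by
  rw [h _ hj (Or.inl (Nat.le_add_right _ _)), phase, if_pos (Nat.le_add_right _ _),
    Nat.add_sub_cancel_left]

theorem not_isPhase (D : MacroCell A) {i e : ℕ} (hi : i < D.n) (he : 0 < e) (he' : e < D.gap) :
    ¬ D.IsPhase (i * D.gap + e) := by
  have h1 := D.mul_gap_add_le hi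
  rintro (h | h)
  · omega
  · rw [Nat.dvd_add_right (Nat.dvd_mul_left _ _)] at h
    exact absurd (Nat.le_of_dvd he h) (by omega)

/-- Two distinct macrocells can overlap only on a few cells. -/
theorem Cand.not_overlap {D : MacroCell A} {x : ℤ → A} {i : ℤ} {d : ℕ} (hi : D.Cand x i)
    (hj : D.Cand x (i + d)) (hd : 0 < d) (hd' : d + D.gap < D.border) : False := by
  obtain ⟨⟨t, ht⟩, hf, -⟩ := hi
  obtain ⟨⟨t', ht'⟩, hf', -⟩ := hj
  have hn := D.n_pos
  have hg : D.gap = D.n + 1 := rfl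
  have hgs := D.gap_le
  have hb : D.border = D.sparse + (2 * D.k + D.n + 2 * D.gap + D.sparse) := rfl
  by_cases hdg : d < D.gap
  · obtain ⟨j, hj, hja⟩ := D.exists_z_add t'
    have h1 := D.mul_gap_add_le hj
    refine hf (j * D.gap + d) (by omega) (D.not_isPhase hj hd hdg) ?_
    rw [← hja, ← ht'.sparse hj]
    congr 1
    push_cast
    ring
  · have key : ∀ c < D.n, D.sparse ≤ d + c * D.gap + 1 →
        d + c * D.gap + D.gap ≤ D.border → False := by
      intro c hc h1 h2
      obtain ⟨j, hj, hja⟩ := D.exists_z_add (t + (d + c * D.gap + 1 - D.sparse))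
      have h3 := D.mul_gap_add_le hc
      refine hf' (c * D.gap + (1 + j)) (by omega) (D.not_isPhase hc (by omega) (by omega)) ?_
      rw [← hja, Nat.add_assoc t, ← ht.dense (by omega)]
      congr 1
      rw [show D.sparse + (d + c * D.gap + 1 - D.sparse + j) = d + c * D.gap + 1 + j by omega]
      push_cast
      ring
    by_cases hds : d < D.sparse
    · have h3 := D.mul_gap_add_le (i := D.n - 1) (by omega)
      have h4 : (D.n - 1) * D.gap + D.gap = D.sparse := by
        rw [← Nat.succ_mul, Nat.succ_eq_add_one, Nat.sub_add_cancel hn]; rfl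
      exact key (D.n - 1) (by omega) (by omega) (by omega)
    · exact key 0 hn (by omega) (by omega)

theorem Cand.eq_or_far {D : MacroCell A} {x : ℤ → A} {i j : ℤ} (hi : D.Cand x i)
    (hj : D.Cand x j) : i = j ∨ (D.border : ℤ) ≤ |i - j| + D.gap := by
  by_contra! h
  obtain ⟨h1, h2⟩ := h
  rcases lt_or_gt_of_ne h1 with h | h
  · rw [abs_of_neg (by omega)] at h2
    obtain ⟨d, hd⟩ := Int.eq_ofNat_of_zero_le (a := j - i) (by omega)
    obtain rfl : j = i + d := by omega
    exact hi.not_overlap hj (by omega) (by omega)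
  · rw [abs_of_pos (by omega)] at h2
    obtain ⟨d, hd⟩ := Int.eq_ofNat_of_zero_le (a := i - j) (by omega)
    obtain rfl : i = j + d := by omega
    exact hj.not_overlap hi (by omega) (by omega)

/-- Macrocells contain the letter `a` far from both of their ends. -/
theorem Cand.exists_eq_a {D : MacroCell A} {x : ℤ → A} {i : ℤ} (hi : D.Cand x i) :
    ∃ r : ℕ, D.k + D.gap ≤ r ∧ r + D.gap < D.border ∧ x (i + r) = D.a := by
  obtain ⟨⟨t, ht⟩, -, -⟩ := hi
  obtain ⟨j, hj, hja⟩ := D.exists_z_add (t + D.k)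
  have hgs := D.gap_le
  have hg : D.gap = D.n + 1 := rfl
  have hb : D.border = D.sparse + (2 * D.k + D.n + 2 * D.gap + D.sparse) := rfl
  refine ⟨D.sparse + (D.k + j), by omega, by omega, ?_⟩
  rw [ht.dense (by omega), ← hja, Nat.add_assoc]

theorem Active.unique {D : MacroCell A} {x : ℤ → A} {p : ℤ} {r r' : ℕ} (hr : r < D.len)
    (hr' : r' < D.len) (h : D.Active x (p - r)) (h' : D.Active x (p - r')) : r = r' := by
  have := h.2 (p - r') (by rw [abs_lt]; constructor <;> omega) h'.1
  omega

theorem Active.ca_eq {D : MacroCell A} {x : ℤ → A} {i : ℤ} (hi : D.Active x i) {r : ℕ}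
    (hr : r < D.len) : D.ca x (i + r) = D.newCell x i r := by
  have h : ∃ r' : ℕ, r' < D.len ∧ D.Active x (i + r - r') := ⟨r, hr, by simpa using hi⟩
  have h2 : h.choose = r := Active.unique h.choose_spec.1 hr h.choose_spec.2 (by simpa using hi)
  rw [ca, dif_pos h, h2]
  simp

theorem ca_eq_of_not (D : MacroCell A) {x : ℤ → A} {p : ℤ}
    (h : ¬ ∃ r : ℕ, r < D.len ∧ D.Active x (p - r)) : D.ca x p = D.φ (x p) := by
  rw [ca, dif_neg h]

theorem cand_congr (D : MacroCell A) {x y : ℤ → A} {i j : ℤ}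
    (h : ∀ q : ℕ, q < D.len → x (i + q) = y (j + q)) (hi : D.Cand x i) : D.Cand y j := by
  obtain ⟨⟨t, ht⟩, hf, hd⟩ := hi
  have hl : D.len = D.border + D.k := rfl
  refine ⟨⟨t, fun r hr hp => ?_⟩, fun r hr hp => ?_, ?_⟩
  · rw [← h r (by omega), ht r hr hp]
  · rw [← h r (by omega)]; exact hf r hr hp
  · convert hd using 1
    funext q
    have := h (D.border + q) (by omega)
    push_cast at this
    simp only [data, add_assoc, this]

theorem active_congr (D : MacroCell A) {x y : ℤ → A} {i j : ℤ}
    (h : ∀ q : ℤ, |q| ≤ 2 * D.len → x (i + q) = y (j + q)) (hi : D.Active x i) :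
    D.Active y j := by
  refine ⟨D.cand_congr (fun q hq => h q (by rw [abs_le]; omega)) hi.1, fun j' hj' hc => ?_⟩
  rw [abs_lt] at hj'
  have := hi.2 (i + (j' - j)) (by rw [abs_lt]; omega) (D.cand_congr (fun q hq => ?_) hc)
  · omega
  · rw [add_assoc i, h _ (by rw [abs_le]; omega)]
    congr 1
    ring

theorem newCell_congr (D : MacroCell A) {x y : ℤ → A} {i j : ℤ}
    (h : ∀ q : ℤ, |q| ≤ 3 * D.len → x (i + q) = y (j + q)) {r : ℕ} (hr : r < D.len) :
    D.newCell x i r = D.newCell y j r := by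
  have hl : D.len = D.border + D.k := rfl
  have hb : D.border = D.sparse + (2 * D.k + D.n + 2 * D.gap + D.sparse) := rfl
  have h1 : D.data x i = D.data y j := by
    funext q
    simp only [data, add_assoc]
    exact h _ (by rw [abs_le]; omega)
  have h2 : D.data x (i + D.len) = D.data y (j + D.len) := by
    funext q
    simp only [data, add_assoc]
    exact h _ (by rw [abs_le]; omega)
  have h3 : D.Active x (i + D.len) ↔ D.Active y (j + D.len) := by
    constructor <;> refine D.active_congr fun q hq => ?_ <;> rw [abs_le] at hq <;>
      simp only [add_assoc]
    · exact h _ (by rw [abs_le]; omega)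
    · exact (h _ (by rw [abs_le]; omega)).symm
  have h4 : D.newData x i = D.newData y j := by
    by_cases hc : D.Active y (j + D.len) ∧ D.R (D.data y j) (D.data y (j + D.len))
    · rw [newData, newData, if_pos hc, if_pos (by rwa [h1, h2, h3]), h2]
    · rw [newData, newData, if_neg hc, if_neg (by rwa [h1, h2, h3]), h1]
  have hm := Nat.mod_lt (D.phase r + 1) D.n_pos
  rw [newCell, newCell, h4, h _ (by rw [abs_le]; omega), h _ (by rw [abs_le]; omega)]

theorem ca_congr (D : MacroCell A) {x y : ℤ → A} {p p' : ℤ}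
    (h : ∀ q : ℤ, |q| ≤ 4 * D.len → x (p + q) = y (p' + q)) : D.ca x p = D.ca y p' := by
  have key : ∀ r < D.len, ∀ q : ℤ, |q| ≤ 3 * D.len → x (p - r + q) = y (p' - r + q) := by
    intro r hr q hq
    rw [abs_le] at hq
    rw [sub_add_eq_add_sub, sub_add_eq_add_sub, add_sub_assoc, add_sub_assoc]
    exact h _ (by rw [abs_le]; omega)
  by_cases hx : ∃ r : ℕ, r < D.len ∧ D.Active x (p - r)
  · obtain ⟨r, hr, ha⟩ := hx
    have ha' : D.Active y (p' - r) := D.active_congr (fun q hq => key r hr q (by omega)) ha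
    have e1 := ha.ca_eq hr
    have e2 := ha'.ca_eq hr
    rw [sub_add_cancel] at e1 e2
    rw [e1, e2, D.newCell_congr (key r hr) hr]
  · have hy : ¬ ∃ r : ℕ, r < D.len ∧ D.Active y (p' - r) := by
      rintro ⟨r, hr, ha⟩
      exact hx ⟨r, hr, D.active_congr (fun q hq => (key r hr q (by omega)).symm) ha⟩
    rw [D.ca_eq_of_not hx, D.ca_eq_of_not hy]
    simpa using congrArg D.φ (h 0 (by simp))

theorem isCA_ca (D : MacroCell A) [TopologicalSpace A] [DiscreteTopology A] : IsCA D.ca := by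
  refine ⟨continuous_pi fun p => ?_, fun x => ?_⟩
  · refine (IsLocallyConstant.iff_exists_open _).2 (fun x => ?_) |>.continuous
    refine ⟨(Set.Icc (p - 4 * D.len) (p + 4 * D.len)).pi fun q => {x q},
      isOpen_set_pi (Set.finite_Icc _ _) fun _ _ => isOpen_discrete _, by simp [Set.mem_pi],
      fun y hy => D.ca_congr fun q hq => ?_⟩
    rw [abs_le] at hq
    exact hy (p + q) ⟨by omega, by omega⟩
  · funext p
    refine D.ca_congr fun q _ => ?_
    simp only [shiftZ]
    congr 1
    ring

theorem Active.data_ca {D : MacroCell A} {x : ℤ → A} {i : ℤ} (hi : D.Active x i) :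
    D.data (D.ca x) i = D.newData x i := by
  funext q
  have hl : D.len = D.border + D.k := rfl
  have h := hi.ca_eq (r := D.border + q) (by omega)
  rw [newCell, dif_pos ⟨by omega, by omega⟩] at h
  push_cast at h
  simp only [Nat.add_sub_cancel_left, ← add_assoc] at h
  exact h

theorem Active.newData_mem {D : MacroCell A} {x : ℤ → A} {i : ℤ} (hi : D.Active x i) :
    D.newData x i ∈ D.B := by
  unfold newData
  split_ifs with h
  · exact h.1.1.2.2
  · exact D.next_mem _ hi.1.2.2

theorem Active.R_newData {D : MacroCell A} {x : ℤ → A} {i : ℤ} (hi : D.Active x i) :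
    D.R (D.data x i) (D.newData x i) := by
  unfold newData
  split_ifs with h
  · exact h.2
  · exact D.R_next _ hi.1.2.2

theorem Active.ca_filler {D : MacroCell A} {x : ℤ → A} {i : ℤ} (hi : D.Active x i) {r : ℕ}
    (hr : r < D.border) (hp : ¬ D.IsPhase r) : D.ca x (i + r) = D.φ (x (i + r)) := by
  have hl : D.len = D.border + D.k := rfl
  rw [hi.ca_eq (by omega), newCell, dif_neg (by omega), if_neg hp]

theorem Active.inPhase_ca {D : MacroCell A} {x : ℤ → A} {i : ℤ} (hi : D.Active x i) {t : ℕ}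
    (ht : D.InPhase x i t) : D.InPhase (D.ca x) i (t + 1) := by
  intro r hr hp
  have hl : D.len = D.border + D.k := rfl
  have hb : D.border = D.sparse + (2 * D.k + D.n + 2 * D.gap + D.sparse) := rfl
  have hm := Nat.mod_lt (D.phase r + 1) D.n_pos
  rw [hi.ca_eq (by omega), newCell, dif_neg (by omega), if_pos hp, ht.dense (by omega),
    D.z_add_mod]
  congr 1
  ring

theorem Active.cand_ca {D : MacroCell A} {x : ℤ → A} {i : ℤ} (hi : D.Active x i) :
    D.Cand (D.ca x) i := by
  obtain ⟨t, ht⟩ := hi.1.1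
  refine ⟨⟨_, hi.inPhase_ca ht⟩, fun r hr hp => ?_, ?_⟩
  · rw [hi.ca_filler hr hp]
    exact D.φ_ne _
  · rw [hi.data_ca]
    exact hi.newData_mem

theorem active_of_cand_ca (D : MacroCell A) {x : ℤ → A} {j : ℤ} (hj : D.Cand (D.ca x) j) :
    D.Active x j := by
  obtain ⟨r, hr, hr', ha⟩ := hj.exists_eq_a
  by_cases hx : ∃ s : ℕ, s < D.len ∧ D.Active x (j + r - s)
  · obtain ⟨s, hs, hact⟩ := hx
    have hl : D.len = D.border + D.k := rfl
    rcases hj.eq_or_far hact.cand_ca with h | h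
    · rwa [← h] at hact
    · exfalso
      rcases abs_cases (j - (j + r - s)) with h' | h' <;> omega
  · rw [D.ca_eq_of_not hx] at ha
    exact absurd ha (D.φ_ne _)

theorem active_ca_iff (D : MacroCell A) {x : ℤ → A} {i : ℤ} :
    D.Active (D.ca x) i ↔ D.Active x i := by
  refine ⟨fun h => D.active_of_cand_ca h.1, fun h => ⟨h.cand_ca, fun j hj hc => ?_⟩⟩
  exact h.2 j hj (D.active_of_cand_ca hc).1

theorem active_iterate_iff (D : MacroCell A) {x : ℤ → A} {i : ℤ} (t : ℕ) :
    D.Active (D.ca^[t] x) i ↔ D.Active x i := by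
  induction t with
  | zero => rfl
  | succ t ih => rw [Function.iterate_succ_apply', active_ca_iff, ih]

/-- The columns of the automaton: orbits of `φ`, shifts of the periodic word, and projections of
paths of the relation `R`. -/
theorem caTrace_ca_cases (D : MacroCell A) (x : ℤ → A) :
    caTrace D.ca x = (fun t => D.φ^[t] (x 0)) ∨ (∃ T, caTrace D.ca x = fun t => D.z (T + t)) ∨
      ∃ γ : ℕ → Fin D.k → A, (∀ t, D.R (γ t) (γ (t + 1))) ∧ ∃ q, caTrace D.ca x = proj q γ := by
  by_cases hx : ∃ r : ℕ, r < D.len ∧ D.Active x (0 - r)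
  · obtain ⟨r, hr, ha⟩ := hx
    obtain ⟨i, hi⟩ : ∃ i : ℤ, i = 0 - r := ⟨_, rfl⟩
    rw [← hi] at ha
    have hact : ∀ t, D.Active (D.ca^[t] x) i := fun t => (D.active_iterate_iff t).2 ha
    have h0 : ∀ t, caTrace D.ca x t = D.ca^[t] x (i + r) := fun t => by
      rw [hi, sub_add_cancel]; rfl
    have hl : D.len = D.border + D.k := rfl
    by_cases hrb : r < D.border
    · by_cases hp : D.IsPhase r
      · obtain ⟨T, hT⟩ := ha.1.1
        have : ∀ t, D.InPhase (D.ca^[t] x) i (T + t) := by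
          intro t
          induction t with
          | zero => exact hT
          | succ t ih =>
            rw [Function.iterate_succ_apply']
            exact (hact t).inPhase_ca ih
        refine Or.inr (Or.inl ⟨T + D.phase r, funext fun t => ?_⟩)
        rw [h0, this t r hrb hp]
        congr 1
        ring
      · refine Or.inl (funext fun t => ?_)
        rw [h0]
        induction t with
        | zero => simp [hi]
        | succ t ih =>
          rw [Function.iterate_succ_apply', Function.iterate_succ_apply',
            (hact t).ca_filler hrb hp, ih]
    · refine Or.inr (Or.inr ⟨fun t => D.data (D.ca^[t] x) i, fun t => ?_,
        ⟨r - D.border, by omega⟩, funext fun t => ?_⟩)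
      · show D.R (D.data (D.ca^[t] x) i) (D.data (D.ca^[t + 1] x) i)
        rw [Function.iterate_succ_apply', (hact t).data_ca]
        exact (hact t).R_newData
      · rw [h0, proj, data]
        exact congrArg _ (by simp only; omega)
  · refine Or.inl (funext fun t => ?_)
    show D.ca^[t] x 0 = _
    induction t with
    | zero => rfl
    | succ t ih =>
      rw [Function.iterate_succ_apply', Function.iterate_succ_apply', D.ca_eq_of_not, ih]
      simpa only [D.active_iterate_iff] using hx

/-- Every projection of a path of `R` in `B` is a column of the automaton. -/
theorem exists_caTrace_ca_eq (D : MacroCell A) {γ : ℕ → Fin D.k → A} (hB : ∀ t, γ t ∈ D.B)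
    (hR : ∀ t, D.R (γ t) (γ (t + 1))) (q : Fin D.k) : ∃ x, caTrace D.ca x = proj q γ := by
  classical
  have hl : D.len = D.border + D.k := rfl
  have hb : D.border = D.sparse + (2 * D.k + D.n + 2 * D.gap + D.sparse) := rfl
  have hlpos : (0 : ℤ) < D.len := by have := q.2; omega
  let cell : ℤ → ℕ → A := fun b r =>
    if h : D.border ≤ r ∧ r - D.border < D.k then γ b.toNat ⟨r - D.border, h.2⟩
    else if D.IsPhase r then D.z (D.phase r) else D.φ D.a
  let pos : ℤ → ℤ := fun b => b * D.len - D.border - q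
  let x : ℤ → A := fun p =>
    cell ((p + D.border + q) / D.len) ((p + D.border + q) % D.len).toNat
  have hx : ∀ b : ℤ, ∀ r : ℕ, r < D.len → x (pos b + r) = cell b r := by
    intro b r hr
    have e : pos b + r + D.border + q = r + b * D.len := by simp only [pos]; ring
    simp only [x]
    rw [e, Int.add_mul_ediv_right _ _ hlpos.ne', Int.add_mul_emod_self_right,
      Int.ediv_eq_zero_of_lt (by omega) (by omega), Int.emod_eq_of_lt (by omega) (by omega)]
    simp
  have hdata : ∀ b : ℤ, D.data x (pos b) = γ b.toNat := by
    intro b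
    funext q'
    have := hx b (D.border + q') (by omega)
    push_cast at this
    rw [data, add_assoc, this]
    simp only [cell]
    rw [dif_pos ⟨by omega, by omega⟩]
    simp
  have hcand : ∀ b : ℤ, D.Cand x (pos b) := by
    intro b
    refine ⟨⟨0, fun r hr hp => ?_⟩, fun r hr hp => ?_, ?_⟩
    · rw [hx b r (by omega)]
      simp only [cell]
      rw [dif_neg (by omega), if_pos hp, Nat.zero_add]
    · rw [hx b r (by omega)]
      simp only [cell]
      rw [dif_neg (by omega), if_neg hp]
      exact D.φ_ne _
    · rw [hdata]
      exact hB _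
  have hpos : ∀ b : ℤ, pos (b + 1) = pos b + D.len := fun b => by simp only [pos]; ring
  have hact : ∀ b : ℤ, D.Active x (pos b) := by
    intro b
    refine ⟨hcand b, fun j hj hc => ?_⟩
    by_contra hne
    have h1 := hpos b
    have h2 := hpos (b - 1)
    rw [sub_add_cancel] at h2
    have h3 := (hcand b).eq_or_far hc
    have h4 := (hcand (b + 1)).eq_or_far hc
    have h5 := (hcand (b - 1)).eq_or_far hc
    have hg : D.gap = D.n + 1 := rfl
    have hn := D.n_pos
    rw [abs_lt] at hj
    rcases abs_cases (pos b - j) with h' | h' <;>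
    rcases abs_cases (pos (b + 1) - j) with h'' | h'' <;>
    rcases abs_cases (pos (b - 1) - j) with h''' | h''' <;> omega
  refine ⟨x, funext fun t => ?_⟩
  have key : ∀ t b : ℕ, D.data (D.ca^[t] x) (pos b) = γ (b + t) := by
    intro t
    induction t with
    | zero => intro b; simpa using hdata b
    | succ t ih =>
      intro b
      have ha := fun b => (D.active_iterate_iff t).2 (hact b)
      have e := ih (b + 1)
      push_cast at e
      rw [hpos] at e
      rw [Function.iterate_succ_apply', (ha b).data_ca, newData, if_pos, e]
      · congr 1
        ring
      · rw [e, ih b, ← hpos]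
        refine ⟨ha _, ?_⟩
        rw [show b + 1 + t = b + t + 1 by ring]
        exact hR _
  have := congrFun (key t 0) q
  simp only [data, pos, Nat.cast_zero, zero_mul, Nat.zero_add] at this
  rw [proj, ← this, caTrace]
  exact congrArg _ (by ring)

end MacroCell

/-- A T3 subshift simulated by a 2-SFT on a product alphabet is traceable. -/
theorem IsT3.traceable [TopologicalSpace A] [DiscreteTopology A] {S : Set (ℕ → A)}
    (hS : ∀ z ∈ S, shiftN z ∈ S) (hT3 : IsT3 S) {k : ℕ} (q₀ : Fin k) {Γ : Set (ℕ → Fin k → A)}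
    (hΓ : IsTwoSFT Γ) (h₀ : S ⊆ proj q₀ '' Γ) (hq : ∀ q, proj q '' Γ ⊆ S) : Traceable S := by
  obtain ⟨φ, hφ, w, hw, ⟨a, haw, ha⟩, z, hz, hper, hzw⟩ := hT3
  obtain ⟨Fb, rfl⟩ := hΓ
  set Γ : Set (ℕ → Fin k → A) := {z | ∀ i : ℕ, (z i, z (i + 1)) ∉ Fb} with hΓ
  have hsucc : ∀ b : Fin k → A, ∃ b', (∃ γ ∈ Γ, γ 0 = b) → (∃ γ ∈ Γ, γ 0 = b') ∧ (b, b') ∉ Fb := by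
    intro b
    by_cases hb : ∃ γ ∈ Γ, γ 0 = b
    · obtain ⟨γ, hγ, rfl⟩ := hb
      exact ⟨γ 1, fun _ => ⟨⟨shiftN γ, fun i => hγ (i + 1), rfl⟩, hγ 0⟩⟩
    · exact ⟨b, fun h => absurd h hb⟩
  choose next hnext using hsucc
  let D : MacroCell A :=
    { n := w.length, k := k, z := z, a := a, φ := φ
      B := {b | ∃ γ ∈ Γ, γ 0 = b}
      R := fun b b' => (b, b') ∉ Fb
      next := next
      z_add := hper
      exists_z := by
        obtain ⟨i, hi⟩ := List.mem_iff_get.1 haw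
        exact ⟨i, i.2, (hzw i).trans hi⟩
      φ_ne := fun b hb => ha ⟨b, hb⟩
      next_mem := fun b hb => (hnext b hb).1
      R_next := fun b hb => (hnext b hb).2 }
  refine ⟨D.ca, D.isCA_ca, Set.Subset.antisymm ?_ ?_⟩
  · rintro _ ⟨x, rfl⟩
    rcases D.caTrace_ca_cases x with h | ⟨T, h⟩ | ⟨γ, hγ, q, h⟩
    · rw [h]
      exact hφ _
    · rw [h]
      clear h
      induction T with
      | zero => simpa using hz
      | succ T ih =>
        convert hS _ ih using 1
        funext t
        simp only [shiftN]
        congr 1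
        ring
    · rw [h]
      exact hq q ⟨γ, hγ, rfl⟩
  · intro s hs
    obtain ⟨γ, hγ, rfl⟩ := h₀ hs
    exact D.exists_caTrace_ca_eq
      (fun t => ⟨fun i => γ (t + i), fun i => hγ (t + i), rfl⟩) hγ q₀

/-- The factor of length `n` of `s` at position `i`. -/
def word (s : ℕ → A) (i n : ℕ) : List A := List.ofFn fun j : Fin n => s (i + j)

@[simp]
theorem length_word (s : ℕ → A) (i n : ℕ) : (word s i n).length = n := by simp [word]

@[simp]
theorem getElem_word (s : ℕ → A) (i n j : ℕ) (h : j < (word s i n).length) :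
    (word s i n)[j] = s (i + j) := by simp [word]

theorem word_congr {s s' : ℕ → A} {i i' n : ℕ} (h : ∀ j < n, s (i + j) = s' (i' + j)) :
    word s i n = word s' i' n :=
  congrArg List.ofFn (funext fun j : Fin n => h j j.2)

theorem word_add (s : ℕ → A) (i m n : ℕ) : word s i (m + n) = word s i m ++ word s (i + m) n := by
  refine List.ext_getElem (by simp) fun j h₁ h₂ => ?_
  rw [List.getElem_append]
  split_ifs with h
  · simp
  · simp only [length_word, not_lt] at h
    rw [getElem_word, getElem_word, length_word]
    congr 1
    omega

theorem mem_lang_iff {S : Set (ℕ → A)} {w : List A} :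
    w ∈ lang S ↔ ∃ z ∈ S, ∃ i, w = word z i w.length :=
  Iff.rfl

theorem word_mem_lang {S : Set (ℕ → A)} {s : ℕ → A} (hs : s ∈ S) (i n : ℕ) :
    word s i n ∈ lang S :=
  mem_lang_iff.2 ⟨s, hs, i, by rw [length_word]⟩

theorem mem_lang_of_append_left {S : Set (ℕ → A)} {u v : List A} (h : u ++ v ∈ lang S) :
    u ∈ lang S := by
  obtain ⟨z, hz, i, e⟩ := mem_lang_iff.1 h
  rw [List.length_append, word_add] at e
  have := (List.append_inj e (by simp)).1
  exact mem_lang_iff.2 ⟨z, hz, _, this⟩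

theorem mem_lang_of_append_right {S : Set (ℕ → A)} {u v : List A} (h : u ++ v ∈ lang S) :
    v ∈ lang S := by
  obtain ⟨z, hz, i, e⟩ := mem_lang_iff.1 h
  rw [List.length_append, word_add] at e
  have := (List.append_inj e (by simp)).2
  exact mem_lang_iff.2 ⟨z, hz, _, this⟩

theorem shift_add_mem {S : Set (ℕ → A)} (hS : ∀ z ∈ S, shiftN z ∈ S) {z : ℕ → A} (hz : z ∈ S)
    (p : ℕ) : (fun t => z (p + t)) ∈ S := by
  induction p with
  | zero => simpa using hz
  | succ p ih =>
    convert hS _ ih using 1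
    funext t
    simp only [shiftN]
    congr 1
    ring

theorem IsSubshift.mem_of_word [TopologicalSpace A] {S : Set (ℕ → A)} (hS : IsSubshift S)
    {s : ℕ → A} (h : ∀ n, ∃ m, n ≤ m ∧ word s 0 m ∈ lang S) : s ∈ S := by
  have : ∀ n, ∃ z ∈ S, ∀ j < n, z j = s j := by
    intro n
    obtain ⟨m, hnm, hm⟩ := h n
    obtain ⟨z, hz, i, e⟩ := mem_lang_iff.1 hm
    rw [length_word] at e
    refine ⟨_, shift_add_mem hS.2 hz i, fun j hj => ?_⟩
    have h1 : (word s 0 m)[j]'(by simp; omega) = (word z i m)[j]'(by simp; omega) := by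
      simp only [e]
    simpa using h1.symm
  choose z hz hzs using this
  refine hS.1.mem_of_tendsto (b := Filter.atTop) (f := z) (tendsto_pi_nhds.2 fun j => ?_)
    (Filter.Eventually.of_forall hz)
  refine tendsto_const_nhds.congr' ?_
  filter_upwards [Filter.eventually_gt_atTop j] with n hn
  exact (hzs n j hn).symm

/-- A subshift which is a projection of a subshift of finite type on a product alphabet, all of
whose projections it includes, is also the projection of such a 2-SFT. -/
theorem exists_isTwoSFT_of_windows {ι : Type*} [Fintype ι] {S : Set (ℕ → A)}
    (hS : ∀ z ∈ S, shiftN z ∈ S) {K : ℕ} (hK : 0 < K) (i₀ : ι) (T : Set (ℕ → ι → A))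
    (hT : ∀ γ : ℕ → ι → A, (∀ t, ∃ τ ∈ T, ∃ t', ∀ j < K, γ (t + j) = τ (t' + j)) →
      ∀ i, (fun t => γ t i) ∈ S)
    (h₀ : ∀ s ∈ S, ∃ τ ∈ T, (fun t => τ t i₀) = s) :
    ∃ k, ∃ q₀ : Fin k, ∃ Γ : Set (ℕ → Fin k → A),
      IsTwoSFT Γ ∧ S ⊆ proj q₀ '' Γ ∧ ∀ q, proj q '' Γ ⊆ S := by
  obtain ⟨e⟩ : Nonempty (ι × Fin K ≃ Fin (Fintype.card (ι × Fin K))) := ⟨Fintype.equivFin _⟩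
  let blk : (ℕ → ι → A) → ℕ → Fin (Fintype.card (ι × Fin K)) → A :=
    fun τ t q => τ (t + (e.symm q).2) (e.symm q).1
  have hblk : ∀ τ t i (j : Fin K), blk τ t (e (i, j)) = τ (t + j) i := by
    intro τ t i j
    simp [blk]
  refine ⟨_, e (i₀, ⟨0, hK⟩),
    {g | ∀ t, (g t, g (t + 1)) ∉ {c | ¬ ∃ τ ∈ T, ∃ t', c.1 = blk τ t' ∧ c.2 = blk τ (t' + 1)}},
    ⟨_, rfl⟩, fun s hs => ?_, ?_⟩
  · obtain ⟨τ, hτ, rfl⟩ := h₀ s hs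
    refine ⟨blk τ, fun t => not_not.2 ⟨τ, hτ, t, rfl, rfl⟩, funext fun t => ?_⟩
    simp [proj, hblk]
  · rintro q _ ⟨g, hg, rfl⟩
    obtain ⟨⟨i, j⟩, rfl⟩ := e.surjective q
    replace hg := fun t => not_not.1 (hg t)
    have key : ∀ (j : ℕ) (hj : j < K) t i,
        g t (e (i, ⟨j, hj⟩)) = g (t + j) (e (i, ⟨0, hK⟩)) := by
      intro j
      induction j with
      | zero => intros; rfl
      | succ j ih =>
        intro hj t i
        obtain ⟨τ, hτ, t', h1, h2⟩ := hg t
        rw [show t + (j + 1) = t + 1 + j by ring, ← ih (by omega)]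
        simp only at h1 h2
        rw [h1, h2, hblk, hblk]
        congr 1
        simp only
        ring_nf
    have h1 := hT (fun t i => g t (e (i, ⟨0, hK⟩))) (fun t => by
      obtain ⟨τ, hτ, t', h1, -⟩ := hg t
      refine ⟨τ, hτ, t', fun j hj => funext fun i => ?_⟩
      rw [← key j hj]
      simp only at h1
      rw [h1, hblk]) i
    convert shift_add_mem hS h1 j using 1
    funext t
    rw [proj, add_comm, ← key]

theorem IsSFT.exists_isTwoSFT {S : Set (ℕ → A)} (hS : ∀ z ∈ S, shiftN z ∈ S) (h : IsSFT S) :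
    ∃ k, ∃ q₀ : Fin k, ∃ Γ : Set (ℕ → Fin k → A),
      IsTwoSFT Γ ∧ S ⊆ proj q₀ '' Γ ∧ ∀ q, proj q '' Γ ⊆ S := by
  obtain ⟨K, Fb, hFb⟩ := h
  refine exists_isTwoSFT_of_windows (ι := Unit) hS (Nat.succ_pos K) ()
    ((fun s t _ => s t) '' S) (fun γ hγ i => ?_) (fun s hs => ⟨_, ⟨s, hs, rfl⟩, rfl⟩)
  rw [hFb]
  intro t
  obtain ⟨_, ⟨s, hs, rfl⟩, t', h⟩ := hγ t
  rw [hFb] at hs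
  have : (fun j : Fin K => γ (t + j) i) = fun j : Fin K => s (t' + j) :=
    funext fun j => congrFun (h j (by omega)) i
  rw [this]
  exact hs t'

/-- A sofic subshift including an infinite transitive subshift includes all the concatenations of
two distinct words of the same length. -/
theorem exists_code [Finite A] [TopologicalSpace A] {S : Set (ℕ → A)} (hS : IsSubshift S)
    (h : IsT2 S) : ∃ n, ∃ u v : ℕ → A, (∃ j < n, u j ≠ v j) ∧ ∀ (β : ℕ → Prop)
      [DecidablePred β], (fun t => if β (t / n) then u (t % n) else v (t % n)) ∈ S := by
  obtain ⟨⟨σ, _, M, hM⟩, Γ, hΓS, hΓ, hinf, htr⟩ := h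
  obtain ⟨y₀, hy₀⟩ := hinf.nonempty
  let R : List A → Set σ := fun w => {q | ∃ x, w ++ x ∈ lang Γ ∧ M.eval (w ++ x) = q}
  obtain ⟨w, ⟨hw, hne⟩, hmin⟩ := (measure fun w => (R w).ncard).wf.has_min
    {w | w ∈ lang Γ ∧ w ≠ []} ⟨word y₀ 0 1, word_mem_lang hy₀ _ _, by simp [word]⟩
  have hext : ∀ x, w ++ x ∈ lang Γ → ∃ y, M.evalFrom (M.eval w) (x ++ y) = M.eval w := by
    intro x hx
    have hsub : R (w ++ x) ⊆ R w := by
      rintro q ⟨y, hy, rfl⟩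
      exact ⟨x ++ y, by rwa [← List.append_assoc], by rw [← List.append_assoc]⟩
    have heq : R (w ++ x) = R w := by
      refine Set.eq_of_subset_of_ncard_le hsub (not_lt.1 fun hlt => ?_) (Set.toFinite _)
      exact hmin (w ++ x) ⟨hx, by simp [hne]⟩ hlt
    have hq : M.eval w ∈ R (w ++ x) := by
      rw [heq]
      exact ⟨[], by simpa using hw, by simp⟩
    obtain ⟨y, -, hy⟩ := hq
    refine ⟨y, ?_⟩
    rw [DFA.eval, ← DFA.evalFrom_of_append, ← List.append_assoc]
    exact hy
  by_cases hbr : ∃ x x', x.length = x'.length ∧ x ≠ x' ∧ w ++ x ∈ lang Γ ∧ w ++ x' ∈ lang Γ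
  · obtain ⟨x, x', hlen, hxx, hx, hx'⟩ := hbr
    obtain ⟨y, hy⟩ := hext x hx
    obtain ⟨y', hy'⟩ := hext x' hx'
    obtain ⟨U, hU⟩ : ∃ U, U = (x ++ y) ++ (x' ++ y') := ⟨_, rfl⟩
    obtain ⟨V, hV⟩ : ∃ V, V = (x' ++ y') ++ (x ++ y) := ⟨_, rfl⟩
    have hUV : U ≠ V := by
      intro e
      rw [hU, hV, List.append_assoc, List.append_assoc x'] at e
      exact hxx (List.append_inj e hlen).1
    have hl : V.length = U.length := by
      rw [hU, hV]
      simp only [List.length_append]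
      omega
    have hUq : M.evalFrom (M.eval w) U = M.eval w := by
      rw [hU, DFA.evalFrom_of_append, hy, hy']
    have hVq : M.evalFrom (M.eval w) V = M.eval w := by
      rw [hV, DFA.evalFrom_of_append, hy', hy]
    have hacc : M.eval w ∈ M.accept := by
      rw [← DFA.mem_accepts, hM]
      obtain ⟨z, hz, e⟩ := mem_lang_iff.1 hw
      exact mem_lang_iff.2 ⟨z, hΓS hz, e⟩
    refine ⟨U.length, fun j => U.getD j (y₀ 0), fun j => V.getD j (y₀ 0), ?_, fun β _ => ?_⟩
    · by_contra! hall
      refine hUV (List.ext_getElem hl.symm fun j h₁ h₂ => ?_)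
      simpa [h₁, h₂] using hall j h₁
    · obtain ⟨s, hs⟩ : ∃ s : ℕ → A, s = fun t => if β (t / U.length)
        then U.getD (t % U.length) (y₀ 0) else V.getD (t % U.length) (y₀ 0) := ⟨_, rfl⟩
      rw [← hs]
      have hpos : 0 < U.length := by
        by_contra h0
        have h0' : U.length = 0 := by omega
        exact hUV ((List.length_eq_zero_iff.1 h0').trans
          (List.length_eq_zero_iff.1 (hl.trans h0')).symm)
      have hblock : ∀ b, word s (b * U.length) U.length = U ∨
          word s (b * U.length) U.length = V := by
        intro b
        have hval : ∀ j < U.length, s (b * U.length + j) =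
            if β b then U.getD j (y₀ 0) else V.getD j (y₀ 0) := by
          intro j hj
          rw [hs]
          simp only
          rw [Nat.mul_comm b, Nat.mul_add_div hpos, Nat.div_eq_of_lt hj, Nat.mul_add_mod,
            Nat.mod_eq_of_lt hj, Nat.add_zero]
        by_cases hb : β b
        · refine Or.inl (List.ext_getElem (by simp) fun j h₁ h₂ => ?_)
          rw [getElem_word, hval j h₂, if_pos hb]
          simp [h₂]
        · refine Or.inr (List.ext_getElem (by simp [hl]) fun j h₁ h₂ => ?_)
          rw [getElem_word, hval j (by omega), if_neg hb]
          simp [h₂]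
      have heval : ∀ b, M.evalFrom (M.eval w) (word s 0 (b * U.length)) = M.eval w := by
        intro b
        induction b with
        | zero => simp [word]
        | succ b ih =>
          rw [Nat.succ_mul, word_add, DFA.evalFrom_of_append, ih, Nat.zero_add]
          rcases hblock b with h | h <;> rw [h] <;> assumption
      refine hS.mem_of_word fun m => ⟨m * U.length, Nat.le_mul_of_pos_right _ hpos, ?_⟩
      refine mem_lang_of_append_right (u := w) ?_
      rw [← hM, DFA.mem_accepts, DFA.eval, DFA.evalFrom_of_append]
      have := heval m
      rw [DFA.eval] at this
      rw [this]
      exact hacc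
  · exfalso
    have huniq : ∀ x x', x.length = x'.length → w ++ x ∈ lang Γ → w ++ x' ∈ lang Γ → x = x' := by
      intro x x' h1 h2 h3
      by_contra h4
      exact hbr ⟨x, x', h1, h4, h2, h3⟩
    obtain ⟨z, hz⟩ := htr w hw w hw
    rw [List.append_assoc] at hz
    obtain ⟨P, hP⟩ : ∃ P, P = (z ++ w).length := ⟨_, rfl⟩
    have hPpos : 0 < P := by
      rw [hP, List.length_append]
      have := List.length_pos_of_ne_nil hne
      omega
    have hper : ∀ x, w ++ x ∈ lang Γ → ∀ i (hi : i + P < x.length), x[i + P] = x[i] := by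
      intro x hx i hi
      have e1 : x.take P = z ++ w := by
        refine huniq _ _ (by rw [List.length_take, ← hP]; omega) ?_ hz
        rw [← List.take_append_drop P x, ← List.append_assoc] at hx
        exact mem_lang_of_append_left hx
      have e2 : x.drop P = x.take (x.drop P).length := by
        refine huniq _ _ (by simp) ?_ ?_
        · rw [← List.take_append_drop P x, e1, ← List.append_assoc, ← List.append_assoc,
            List.append_assoc (w ++ z)] at hx
          exact mem_lang_of_append_right hx
        · rw [← List.take_append_drop (x.drop P).length x, ← List.append_assoc] at hx
          exact mem_lang_of_append_left hx
      have h1 : (x.drop P)[i]'(by simp; omega) =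
          (x.take (x.drop P).length)[i]'(by simp; omega) := by
        congr 1
      simpa [Nat.add_comm] using h1
    have hperΓ : ∀ y ∈ Γ, Function.Periodic y P := by
      intro y hy i
      obtain ⟨z', hz'⟩ := htr w hw _ (word_mem_lang hy 0 (i + P + 1))
      rw [List.append_assoc] at hz'
      have h1 := hper _ hz' (z'.length + i) (by simp; omega)
      rw [List.getElem_append_right (by omega), List.getElem_append_right (by omega)] at h1
      simpa [Nat.add_assoc] using h1
    refine hinf (Set.Finite.of_finite_image (f := fun y (j : Fin P) => y j) (Set.toFinite _) ?_)
    intro y hy y' hy' e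
    funext i
    rw [← (hperΓ y hy).map_mod_nat, ← (hperΓ y' hy').map_mod_nat]
    exact congrFun e ⟨i % P, Nat.mod_lt _ hPpos⟩

/-- The periodic word `(uuuv)^ω`, where `u` and `v` have length `n`. -/
def clock (n : ℕ) (u v : ℕ → A) (t : ℕ) : A := if t / n % 4 < 3 then u (t % n) else v (t % n)

theorem periodic_clock {n : ℕ} (hn : 0 < n) (u v : ℕ → A) :
    Function.Periodic (clock n u v) (n * 4) := by
  intro t
  simp [clock, Nat.add_mul_div_left _ _ hn]

/-- The word `(uuuv)^ω` has least period `4n`. -/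
theorem clock_injective {n : ℕ} {u v : ℕ → A} (huv : ∃ j < n, u j ≠ v j) {a b : ℕ}
    (h : ∀ t < n * 4, clock n u v (a + t) = clock n u v (b + t)) :
    a % (n * 4) = b % (n * 4) := by
  obtain ⟨j₀, hj₀, hne⟩ := huv
  have hn : 0 < n := by omega
  have hper := periodic_clock hn u v
  have hmod := hper.map_mod_nat
  have hN : 0 < n * 4 := by omega
  by_contra hab
  wlog hlt : a % (n * 4) < b % (n * 4) generalizing a b
  · exact this (fun t ht => (h t ht).symm) (fun e => hab e.symm) (by omega)
  have hb := Nat.mod_lt b hN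
  have h' : ∀ t, clock n u v (a % (n * 4) + t) = clock n u v (b % (n * 4) + t) := by
    intro t
    have := h (t % (n * 4)) (Nat.mod_lt _ hN)
    rw [← hmod, ← hmod (b + _), ← Nat.add_mod_mod, ← Nat.add_mod_mod] at this
    rw [← hmod, ← hmod (b % (n * 4) + t), Nat.mod_add_mod, Nat.mod_add_mod]
    simpa using this
  have hd : ∃ d, 0 < d ∧ d ≤ 2 * n ∧ Function.Periodic (clock n u v) d := by
    have hp : Function.Periodic (clock n u v) (b % (n * 4) - a % (n * 4)) := by
      intro t
      rw [← hper t, ← hper (t + _)]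
      have := h' (t + n * 4 - a % (n * 4))
      rw [show a % (n * 4) + (t + n * 4 - a % (n * 4)) = t + n * 4 by omega] at this
      rw [this]
      congr 1
      omega
    by_cases hle : b % (n * 4) - a % (n * 4) ≤ 2 * n
    · exact ⟨_, by omega, hle, hp⟩
    · refine ⟨n * 4 - (b % (n * 4) - a % (n * 4)), by omega, by omega, fun t => ?_⟩
      rw [← hp, ← hper t]
      congr 1
      omega
  obtain ⟨d, hd0, hd2, hd⟩ := hd
  have hu : ∀ i < 3 * n, clock n u v i = u (i % n) := by
    intro i hi
    have : i / n < 3 := Nat.div_lt_of_lt_mul (by omega)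
    rw [clock, if_pos ((Nat.mod_le _ _).trans_lt this)]
  have hnper : ∀ i, clock n u v (i + n) = clock n u v i := by
    intro i
    have hlt := Nat.mod_lt i hd0
    have hd' : Function.Periodic (fun i => clock n u v (i + n)) d := by
      intro i
      simp only
      rw [add_right_comm, hd]
    have e1 : clock n u v (i % d + n) = clock n u v (i + n) := hd'.map_mod_nat i
    have e2 := hd.map_mod_nat i
    rw [← e1, ← e2, hu _ (by omega), hu _ (by omega), Nat.add_mod_right]
  have e := hnper (n * 2 + j₀)
  rw [hu (n * 2 + j₀) (by omega), show n * 2 + j₀ + n = n * 3 + j₀ by ring, clock, Nat.mul_add_div hn,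
    Nat.div_eq_of_lt hj₀, if_neg (by omega), Nat.mul_add_mod, Nat.mul_add_mod,
    Nat.mod_eq_of_lt hj₀] at e
  exact hne e.symm

open Classical in
/-- The encoding, in columns made of the words `u` and `v` of length `n`, of the states of an
automaton reading `s`. -/
noncomputable def encode {σ : Type*} (M : DFA A σ) (n : ℕ) (u v : ℕ → A) (s : ℕ → A) (t : ℕ) :
    Option (Option σ) → A
  | none => s t
  | some none => clock n u v t
  | some (some q) =>
    if M.eval (word s 0 (t / (n * 4) * (n * 4))) = q then u (t % n) else v (t % n)

theorem encode_mul_add {σ : Type*} (M : DFA A σ) {n : ℕ} (u v : ℕ → A) (s : ℕ → A) (c : ℕ)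
    {i : ℕ} (hi : i < n * 4) (q : σ) [Decidable (M.eval (word s 0 (c * (n * 4))) = q)] :
    encode M n u v s (c * (n * 4) + i) (some (some q)) =
      if M.eval (word s 0 (c * (n * 4))) = q then u (i % n) else v (i % n) := by
  have h1 : (c * (n * 4) + i) / (n * 4) = c := by
    rw [Nat.mul_comm c, Nat.mul_add_div (by omega), Nat.div_eq_of_lt hi, Nat.add_zero]
  have h2 : (c * (n * 4) + i) % n = i % n := by
    rw [show c * (n * 4) + i = n * (c * 4) + i by ring, Nat.mul_add_mod]
  simp only [encode, h1, h2]

theorem IsT2.exists_isTwoSFT [Finite A] [TopologicalSpace A] {S : Set (ℕ → A)}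
    (hS : IsSubshift S) (h : IsT2 S) : ∃ k, ∃ q₀ : Fin k, ∃ Γ : Set (ℕ → Fin k → A),
      IsTwoSFT Γ ∧ S ⊆ proj q₀ '' Γ ∧ ∀ q, proj q '' Γ ⊆ S := by
  classical
  obtain ⟨n, u, v, huv, hcode⟩ := exists_code hS h
  obtain ⟨⟨σ, _, M, hM⟩, -⟩ := h
  have hn : 0 < n := by
    obtain ⟨j, hj, -⟩ := huv
    omega
  obtain ⟨N, hN⟩ : ∃ N, N = n * 4 := ⟨_, rfl⟩
  have hNpos : 0 < N := by omega
  have hclock := hcode fun b => b % 4 < 3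
  have hcol : ∀ β : ℕ → Prop, (fun t => if β (t / N) then u (t % n) else v (t % n)) ∈ S := by
    intro β
    have := hcode fun b => β (b / 4)
    simpa only [Nat.div_div_eq_div_mul, ← hN] using this
  refine exists_isTwoSFT_of_windows (ι := Option (Option σ)) (K := 2 * N) hS.2 (by omega) none
    (encode M n u v '' S) (fun γ hγ => ?_) (fun s hs => ⟨_, ⟨s, hs, rfl⟩, rfl⟩)
  have hγ' : ∀ t, ∃ s ∈ S, ∃ t', ∀ j < 2 * N, γ (t + j) = encode M n u v s (t' + j) := by
    intro t
    obtain ⟨_, ⟨s, hs, rfl⟩, h⟩ := hγ t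
    exact ⟨s, hs, h⟩
  choose s hs τ hτ using hγ'
  have hτ_mod : ∀ t, τ t % N = (τ 0 % N + t) % N := by
    intro t
    induction t with
    | zero => simp
    | succ t ih =>
      have : τ (t + 1) % N = (τ t + 1) % N := by
        rw [hN]
        refine clock_injective huv fun j hj => ?_
        have e1 := congrFun (hτ (t + 1) j (by omega)) (some none)
        have e2 := congrFun (hτ t (1 + j) (by omega)) (some none)
        rw [show t + (1 + j) = t + 1 + j by ring, ← Nat.add_assoc] at e2
        exact e1.symm.trans e2
      rw [this, Nat.add_mod, ih, ← Nat.add_mod, Nat.add_assoc]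
  obtain ⟨p, hp⟩ : ∃ p, p = τ 0 % N := ⟨_, rfl⟩
  have hpN : p < N := hp ▸ Nat.mod_lt _ hNpos
  rw [← hp] at hτ_mod
  -- the position of the beginning of block `b`, and the state encoded there
  let start : ℕ → ℕ := fun b => b * N - p
  let Q : ℕ → σ := fun b => M.eval (word (s (start b)) 0 (τ (start b) / N * N))
  have hQ : ∀ b e i, p + start b = b * N + e → e + i < N → ∀ q,
      γ (start b + i) (some (some q)) = if Q b = q then u ((e + i) % n) else v ((e + i) % n) := by
    intro b e i he hei q
    have h1 : τ (start b) % N = e := by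
      rw [hτ_mod, he, Nat.mul_comm, Nat.mul_add_mod, Nat.mod_eq_of_lt (by omega)]
    have h2 : τ (start b) + i = τ (start b) / N * N + (e + i) := by
      have := Nat.div_add_mod' (τ (start b)) N
      omega
    rw [hτ (start b) i (by omega), h2]
    subst hN
    exact encode_mul_add M u v _ _ hei q
  have hstart : ∀ b, p + start (b + 1) = (b + 1) * N := by
    intro b
    have : (b + 1) * N = b * N + N := Nat.succ_mul _ _
    simp only [start]
    omega
  have hstep : ∀ t m b, m ≤ N → t + m = start (b + 1) →
      M.eval (word (s t) 0 (τ t) ++ word (fun t => γ t none) t m) = Q (b + 1) := by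
    intro t m b hm htm
    obtain ⟨j, hj, hne⟩ := huv
    have e1 : word (fun t => γ t none) t m = word (s t) (0 + τ t) m := by
      refine word_congr fun j hj => ?_
      have := congrFun (hτ t j (by omega)) none
      rw [this, Nat.zero_add]
      rfl
    have e2 : (τ t + m) % N = 0 := by
      rw [Nat.add_mod, hτ_mod, ← Nat.add_mod, Nat.add_assoc, htm, hstart]
      exact Nat.mul_mod_left _ _
    have e3 : τ t + m = (τ t + m) / N * N := by
      have := Nat.div_add_mod' (τ t + m) N
      omega
    rw [e1, ← word_add, e3]
    have e4 := hQ (b + 1) 0 j (hstart b) (by omega) (Q (b + 1))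
    rw [← htm, Nat.add_assoc, hτ t (m + j) (by omega), ← Nat.add_assoc, e3] at e4
    by_contra hcon
    subst hN
    rw [encode_mul_add M u v _ _ (by omega), if_neg hcon, if_pos rfl, Nat.zero_add,
      Nat.mod_eq_of_lt hj] at e4
    exact hne e4.symm
  rintro (_ | _ | q)
  · have hpath : ∀ b, M.eval (word (s 0) 0 (τ 0) ++ word (fun t => γ t none) 0 (start (b + 1))) =
        Q (b + 1) := by
      intro b
      induction b with
      | zero => exact hstep 0 (start 1) 0 (by simp [start]) (by simp)
      | succ b ih =>
        have h1 : start (b + 1 + 1) = start (b + 1) + N := by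
          have h2 := hstart b
          have h3 := hstart (b + 1)
          have : (b + 1 + 1) * N = (b + 1) * N + N := Nat.succ_mul _ _
          omega
        have h2 := hstep (start (b + 1)) N (b + 1) le_rfl h1.symm
        have h3 : τ (start (b + 1)) / N * N = τ (start (b + 1)) := by
          have h4 := Nat.div_add_mod' (τ (start (b + 1))) N
          rw [hτ_mod, hstart, Nat.mul_mod_left] at h4
          exact h4
        have h5 : Q (b + 1) = M.eval (word (s (start (b + 1))) 0 (τ (start (b + 1)))) := by
          simp only [Q, h3]
        rw [DFA.eval, DFA.evalFrom_of_append] at h2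
        rw [h1, word_add, ← List.append_assoc, DFA.eval, DFA.evalFrom_of_append, ← DFA.eval, ih,
          h5, Nat.zero_add]
        exact h2
    refine hS.mem_of_word fun m => ⟨start (m + 1), ?_, ?_⟩
    · have h1 := hstart m
      have h2 : (m + 1) * N = m * N + N := Nat.succ_mul _ _
      have h3 : m ≤ m * N := Nat.le_mul_of_pos_right _ hNpos
      omega
    · refine mem_lang_of_append_right (u := word (s 0) 0 (τ 0)) ?_
      rw [← hM, DFA.mem_accepts, hpath, ← DFA.mem_accepts, hM]
      exact word_mem_lang (hs _) _ _
  · convert shift_add_mem hS.2 hclock p using 1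
    funext t
    have h1 := congrFun (hτ t 0 (by omega)) (some none)
    have hper := periodic_clock hn u v
    rw [← hN] at hper
    change γ t _ = clock n u v (τ t) at h1
    rw [h1, ← hper.map_mod_nat, hτ_mod, hper.map_mod_nat]
    rfl
  · convert shift_add_mem hS.2 (hcol fun b => Q b = q) p using 1
    funext t
    obtain ⟨b, hb⟩ : ∃ b, b = (p + t) / N := ⟨_, rfl⟩
    have h1 := Nat.div_add_mod' (p + t) N
    have h2 := Nat.mod_lt (p + t) hNpos
    rw [← hb] at h1
    have h3 : p + start b = b * N + (p + start b - b * N) := by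
      simp only [start]
      omega
    have h4 : start b ≤ t := by
      simp only [start]
      omega
    have h5 := hQ b _ (t - start b) h3 (by omega) q
    rw [Nat.add_sub_cancel' h4] at h5
    rw [h5, ← hb]
    have h6 : (p + t) % n = (p + start b - b * N + (t - start b)) % n := by
      have : p + t = n * (b * 4) + (p + start b - b * N + (t - start b)) := by
        have : n * (b * 4) = b * N := by rw [hN]; ring
        omega
      rw [this, Nat.mul_add_mod]
    simp only [h6]

theorem IsT1.exists_isTwoSFT {S : Set (ℕ → A)} (h : IsT1 S) :
    ∃ k, ∃ q₀ : Fin k, ∃ Γ : Set (ℕ → Fin k → A),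
      IsTwoSFT Γ ∧ S ⊆ proj q₀ '' Γ ∧ ∀ q, proj q '' Γ ⊆ S := by
  obtain ⟨k, hk, Γ, hΓ, h₀, hall⟩ := h
  refine ⟨k, ⟨0, hk⟩, Γ, hΓ, h₀.ge, fun q => ?_⟩
  rw [← hall]
  exact Set.subset_iUnion (fun q => proj q '' Γ) q

/-- Any T3 subshift which is moreover T1, or an SFT, or T2, is traceable. -/
theorem stmt10 [Fintype A] [TopologicalSpace A] [DiscreteTopology A]
    (hA : 2 ≤ Fintype.card A) (S : Set (ℕ → A)) (hS : IsSubshift S) (hT3 : IsT3 S)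
    (h : IsT1 S ∨ IsSFT S ∨ IsT2 S) :
    Traceable S := by
  obtain ⟨k, q₀, Γ, hΓ, h₀, hq⟩ : ∃ k, ∃ q₀ : Fin k, ∃ Γ : Set (ℕ → Fin k → A),
      IsTwoSFT Γ ∧ S ⊆ proj q₀ '' Γ ∧ ∀ q, proj q '' Γ ⊆ S := by
    rcases h with h | h | h
    · exact h.exists_isTwoSFT
    · exact h.exists_isTwoSFT hS.2
    · exact h.exists_isTwoSFT hS
  exact hT3.traceable hS.2 q₀ hΓ h₀ hq
end
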